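/- Let n ≥ 1, 1 < p < ∞, 0 < q < p−1, 0 < α < n/p, and n(p−1)/(n−αp) < r < ∞, and let σ be a locally finite nonnegative Borel measure on ℝⁿ with σ ≠ 0. Then there exists a solution u of the integral equation u = W_{α,p}(u^q dσ) with u > 0 Lebesgue-a.e. and u ∈ L^r(ℝⁿ) (with respect to Lebesgue measure) if and only if K_{α,p,q}σ ∈ L^r(ℝⁿ). -/

import Mathlib

open MeasureTheory Metric Set
open scoped ENNReal NNReal

/-- The Wolff potential `W_{α,p}ν(x) = ∫₀^∞ (ν(B(x,ρ))/ρ^{n−αp})^{1/(p−1)} dρ/ρ`. -/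
noncomputable def wolffPot (n : ℕ) (α p : ℝ)
    (ν : Measure (EuclideanSpace ℝ (Fin n))) (x : EuclideanSpace ℝ (Fin n)) : ℝ≥0∞ :=
  ∫⁻ ρ in Set.Ioi (0 : ℝ),
    (ν (Metric.ball x ρ) / ENNReal.ofReal (ρ ^ ((n : ℝ) - α * p))) ^ (1 / (p - 1)) /
      ENNReal.ofReal ρ

/-- The least constant `κ(E)` such that
`(∫_E (W_{α,p}ν)^q dσ)^{1/q} ≤ κ · ν(ℝⁿ)^{1/(p−1)}` for all finite measures `ν`. -/
noncomputable def embC (n : ℕ) (α p q : ℝ) (σ : Measure (EuclideanSpace ℝ (Fin n)))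
    (E : Set (EuclideanSpace ℝ (Fin n))) : ℝ≥0∞ :=
  sInf {κ : ℝ≥0∞ | ∀ ν : Measure (EuclideanSpace ℝ (Fin n)), IsFiniteMeasure ν →
    (∫⁻ y in E, wolffPot n α p ν y ^ q ∂σ) ^ (1 / q) ≤ κ * (ν Set.univ) ^ (1 / (p - 1))}

/-- The intrinsic potential of Wolff type
`K_{α,p,q}σ(x) = ∫₀^∞ (κ(B(x,ρ))^{q(p−1)/(p−1−q)}/ρ^{n−αp})^{1/(p−1)} dρ/ρ`. -/
noncomputable def intK (n : ℕ) (α p q : ℝ) (σ : Measure (EuclideanSpace ℝ (Fin n)))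
    (x : EuclideanSpace ℝ (Fin n)) : ℝ≥0∞ :=
  ∫⁻ ρ in Set.Ioi (0 : ℝ),
    (embC n α p q σ (Metric.ball x ρ) ^ (q * (p - 1) / (p - 1 - q)) /
      ENNReal.ofReal (ρ ^ ((n : ℝ) - α * p))) ^ (1 / (p - 1)) / ENNReal.ofReal ρ

/-- `u` is a solution of the integral equation `u = W_{α,p}(u^q dσ)`:
`u` is Borel measurable, `u ∈ L^q_loc(σ)`, and the equation holds
`σ`-a.e. and Lebesgue-a.e. -/
def IsSolution (n : ℕ) (α p q : ℝ) (σ : Measure (EuclideanSpace ℝ (Fin n)))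
    (u : EuclideanSpace ℝ (Fin n) → ℝ≥0∞) : Prop :=
  Measurable u ∧
  (∀ x : EuclideanSpace ℝ (Fin n), ∀ R : ℝ, 0 < R →
    (∫⁻ y in Metric.ball x R, u y ^ q ∂σ) < ⊤) ∧
  (∀ᵐ x ∂σ, u x = wolffPot n α p (σ.withDensity fun y => u y ^ q) x) ∧
  (∀ᵐ x ∂(volume : Measure (EuclideanSpace ℝ (Fin n))),
    u x = wolffPot n α p (σ.withDensity fun y => u y ^ q) x)

/-- The functional `m ↦ ∫₀^∞ (m(ρ)/ρ^γ)^s dρ/ρ` behind the Wolff potential. -/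
noncomputable def radialWolff (s γ : ℝ) (m : ℝ → ℝ≥0∞) : ℝ≥0∞ :=
  ∫⁻ ρ in Set.Ioi (0 : ℝ), (m ρ / ENNReal.ofReal (ρ ^ γ)) ^ s / ENNReal.ofReal ρ

lemma radialWolff_mono {s γ : ℝ} (hs : 0 ≤ s) {m m' : ℝ → ℝ≥0∞}
    (h : ∀ ρ, 0 < ρ → m ρ ≤ m' ρ) : radialWolff s γ m ≤ radialWolff s γ m' := by
  refine setLIntegral_mono' measurableSet_Ioi fun ρ hρ => ?_
  have := h ρ hρ
  gcongr

lemma radialWolff_const_mul {s γ : ℝ} (hs : 0 ≤ s) {c : ℝ≥0∞} (hc : c ≠ ⊤) (m : ℝ → ℝ≥0∞) :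
    radialWolff s γ (fun ρ => c * m ρ) = c ^ s * radialWolff s γ m := by
  unfold radialWolff
  rw [← lintegral_const_mul' _ _ (ENNReal.rpow_ne_top_of_nonneg hs hc)]
  refine lintegral_congr fun ρ => ?_
  rw [mul_div_assoc, ENNReal.mul_rpow_of_nonneg _ _ hs, mul_div_assoc]

lemma lintegral_Ioi_eq_comp_two_mul (F : ℝ → ℝ≥0∞) :
    ∫⁻ ρ in Ioi (0 : ℝ), F ρ = ∫⁻ ρ in Ioi (0 : ℝ), 2 * F (2 * ρ) := by
  have himg : (fun ρ : ℝ => 2 * ρ) '' Ioi 0 = Ioi 0 := by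
    ext y
    constructor
    · rintro ⟨ρ, hρ, rfl⟩
      have : (0 : ℝ) < ρ := hρ
      simpa using this
    · intro hy
      have : (0 : ℝ) < y := hy
      exact ⟨y / 2, by simpa using this, by simp only; ring⟩
  have h := lintegral_image_eq_lintegral_abs_deriv_mul (s := Ioi (0 : ℝ))
    (f := fun ρ => 2 * ρ) (f' := fun _ => 2) measurableSet_Ioi
    (fun x _ => by simpa using ((hasDerivAt_id x).const_mul 2).hasDerivWithinAt)
    (fun x _ y _ hxy => by simpa using hxy) F
  rw [himg] at h
  rw [h]
  simp

lemma radialWolff_comp_two_mul {s : ℝ} (γ : ℝ) (hs : 0 ≤ s) (m : ℝ → ℝ≥0∞) :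
    radialWolff s γ (fun ρ => m (2 * ρ)) = ENNReal.ofReal (2 ^ γ) ^ s * radialWolff s γ m := by
  unfold radialWolff
  rw [lintegral_Ioi_eq_comp_two_mul (fun ρ => (m ρ / ENNReal.ofReal (ρ ^ γ)) ^ s /
    ENNReal.ofReal ρ), ← lintegral_const_mul' _ _
      (ENNReal.rpow_ne_top_of_nonneg hs ENNReal.ofReal_ne_top)]
  refine setLIntegral_congr_fun measurableSet_Ioi fun ρ hρ => ?_
  have hρ : (0 : ℝ) < ρ := hρ
  have h2 : (0 : ℝ) < 2 ^ γ := by positivity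
  have e1 : m (2 * ρ) / ENNReal.ofReal (ρ ^ γ) =
      ENNReal.ofReal (2 ^ γ) * (m (2 * ρ) / ENNReal.ofReal ((2 * ρ) ^ γ)) := by
    rw [Real.mul_rpow (by norm_num) hρ.le, ENNReal.ofReal_mul h2.le, ← mul_div_assoc,
      ENNReal.mul_div_mul_left _ _ (by simpa using h2) ENNReal.ofReal_ne_top]
  simp only
  rw [e1, ENNReal.mul_rpow_of_nonneg _ _ hs, mul_div_assoc]
  congr 1
  rw [ENNReal.ofReal_mul (by norm_num), ← mul_div_assoc]
  simp only [ENNReal.ofReal_ofNat]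
  rw [ENNReal.mul_div_mul_left _ _ (by norm_num) (by norm_num)]

lemma measurable_radialWolff_integrand (s γ : ℝ) {m : ℝ → ℝ≥0∞} (hm : Measurable m) :
    Measurable fun ρ : ℝ => (m ρ / ENNReal.ofReal (ρ ^ γ)) ^ s / ENNReal.ofReal ρ := by
  fun_prop

lemma le_radialWolff {s γ : ℝ} (hs : 0 ≤ s) (hγ : 0 ≤ γ) {m : ℝ → ℝ≥0∞} (hm : Monotone m)
    {t : ℝ} (ht : 0 < t) :
    (m t / ENNReal.ofReal ((2 * t) ^ γ)) ^ s / 2 ≤ radialWolff s γ m := by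
  have h2t : 0 < 2 * t := by positivity
  calc (m t / ENNReal.ofReal ((2 * t) ^ γ)) ^ s / 2
      = (m t / ENNReal.ofReal ((2 * t) ^ γ)) ^ s / ENNReal.ofReal (2 * t) *
          volume (Ioc t (2 * t)) := by
        rw [Real.volume_Ioc, show 2 * t - t = t by ring, ENNReal.ofReal_mul (by norm_num)]
        simp only [ENNReal.ofReal_ofNat]
        rw [ENNReal.mul_div_right_comm.symm, ENNReal.mul_div_mul_right _ _ (by simpa using ht)
          ENNReal.ofReal_ne_top]
    _ = ∫⁻ _ in Ioc t (2 * t),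
          (m t / ENNReal.ofReal ((2 * t) ^ γ)) ^ s / ENNReal.ofReal (2 * t) := by
        rw [setLIntegral_const]
    _ ≤ ∫⁻ ρ in Ioc t (2 * t), (m ρ / ENNReal.ofReal (ρ ^ γ)) ^ s / ENNReal.ofReal ρ := by
        refine setLIntegral_mono' measurableSet_Ioc fun ρ hρ => ?_
        have hρ0 : 0 < ρ := ht.trans hρ.1
        have := hm hρ.1.le
        have h3 : ρ ^ γ ≤ (2 * t) ^ γ := Real.rpow_le_rpow hρ0.le hρ.2 hγ
        have := hρ.2
        gcongr
    _ ≤ _ := lintegral_mono_set fun ρ hρ => ht.trans hρ.1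

/-- Weak type `(1,1)` bound for the centered maximal function of `ν` with respect to `ω`. -/
lemma exists_weakType_centered (X : Type*) [MetricSpace X] [MeasurableSpace X] [BorelSpace X]
    [TopologicalSpace.SeparableSpace X] [HasBesicovitchCovering X] :
    ∃ N : ℕ, ∀ (ω ν : Measure X) (t : ℝ≥0∞),
      t * ω {x | ∃ ρ : ℝ, 0 < ρ ∧ t * ω (ball x ρ) < ν (ball x ρ)} ≤ N * ν univ := by
  obtain ⟨N, τ, hτ, hN⟩ := HasBesicovitchCovering.no_satelliteConfig (α := X)
  refine ⟨N, fun ω ν t => ?_⟩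
  set S : ℕ → Set X := fun R =>
    {x | ∃ ρ : ℝ, 0 < ρ ∧ ρ ≤ R ∧ t * ω (closedBall x ρ) < ν (closedBall x ρ)} with hS
  have hmono : Monotone S := by
    rintro a b hab x ⟨ρ, h1, h2, h3⟩
    exact ⟨ρ, h1, h2.trans (by exact_mod_cast hab), h3⟩
  have hsub : {x | ∃ ρ : ℝ, 0 < ρ ∧ t * ω (ball x ρ) < ν (ball x ρ)} ⊆ ⋃ R, S R := by
    rintro x ⟨ρ, hρ, hlt⟩
    have hU : ball x ρ = ⋃ k : ℕ, closedBall x (ρ - ρ / (k + 2)) := by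
      ext y
      simp only [mem_ball, mem_iUnion, mem_closedBall]
      constructor
      · intro hy
        have hpos : 0 < (ρ - dist y x) / ρ := div_pos (by linarith) hρ
        obtain ⟨k, hk⟩ := exists_nat_one_div_lt hpos
        refine ⟨k, ?_⟩
        have h1 : ρ / (k + 2) ≤ ρ / (k + 1) := by gcongr; norm_num
        have h2 : ρ / ((k : ℝ) + 1) < ρ - dist y x := by
          rw [lt_div_iff₀ hρ] at hk
          calc ρ / ((k : ℝ) + 1) = 1 / (k + 1) * ρ := by ring
            _ < _ := hk
        linarith
      · rintro ⟨k, hk⟩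
        have : 0 < ρ / ((k : ℝ) + 2) := by positivity
        linarith
    have hmonoB : Monotone fun k : ℕ => closedBall x (ρ - ρ / ((k : ℝ) + 2)) := by
      intro a b hab
      refine closedBall_subset_closedBall ?_
      have : (a : ℝ) ≤ b := by exact_mod_cast hab
      gcongr
    have hν : ν (ball x ρ) = ⨆ k : ℕ, ν (closedBall x (ρ - ρ / ((k : ℝ) + 2))) := by
      rw [← hmonoB.measure_iUnion, ← hU]
    rw [hν, lt_iSup_iff] at hlt
    obtain ⟨k, hk⟩ := hlt
    have hk2 : 0 < ρ / ((k : ℝ) + 2) := by positivity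
    have hk1 : ρ / ((k : ℝ) + 2) < ρ := by
      refine div_lt_self hρ ?_
      have : (0 : ℝ) ≤ k := by positivity
      linarith
    obtain ⟨R, hR⟩ := exists_nat_ge ρ
    refine mem_iUnion.2 ⟨R, _, by linarith, by linarith, lt_of_le_of_lt ?_ hk⟩
    gcongr
    rw [hU]
    exact subset_iUnion (fun k : ℕ => closedBall x (ρ - ρ / ((k : ℝ) + 2))) k
  have hSR : ∀ R, t * ω (S R) ≤ N * ν univ := by
    intro R
    choose! ρ hρ0 hρR hρ using fun (x : X) (hx : x ∈ S R) => hx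
    let P : Besicovitch.BallPackage (S R) X :=
      { c := fun x => x
        r := fun x => ρ x
        rpos := fun x => hρ0 x x.2
        r_bound := R
        r_le := fun x => hρR x x.2 }
    obtain ⟨s, hs1, hs2⟩ := Besicovitch.exist_disjoint_covering_families hτ hN P
    have hcount : ∀ i, (s i).Countable := fun i =>
      (hs1 i).countable_of_nonempty_interior fun j _ =>
        ⟨j, mem_interior.2 ⟨ball j (ρ j), ball_subset_closedBall, isOpen_ball,
          mem_ball_self (hρ0 j j.2)⟩⟩
    have hcov : S R ⊆ ⋃ i, ⋃ j ∈ s i, closedBall (P.c j) (P.r j) := by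
      intro x hx
      have : x ∈ range P.c := ⟨⟨x, hx⟩, rfl⟩
      have := hs2 this
      simp only [mem_iUnion] at this ⊢
      obtain ⟨i, j, hj, hx⟩ := this
      exact ⟨i, j, hj, ball_subset_closedBall hx⟩
    have hone : ∀ i, t * ω (⋃ j ∈ s i, closedBall (P.c j) (P.r j)) ≤ ν univ := by
      intro i
      have : Countable (s i) := (hcount i).to_subtype
      calc t * ω (⋃ j ∈ s i, closedBall (P.c j) (P.r j))
          ≤ t * ∑' j : s i, ω (closedBall (P.c j) (P.r j)) := by
            gcongr
            exact measure_biUnion_le _ (hcount i) _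
        _ = ∑' j : s i, t * ω (closedBall (P.c j) (P.r j)) := ENNReal.tsum_mul_left.symm
        _ ≤ ∑' j : s i, ν (closedBall (P.c j) (P.r j)) :=
            ENNReal.tsum_le_tsum fun j => (hρ _ j.1.2).le
        _ = ν (⋃ j ∈ s i, closedBall (P.c j) (P.r j)) :=
            (measure_biUnion (hcount i) (hs1 i) fun j _ => measurableSet_closedBall).symm
        _ ≤ ν univ := measure_mono (subset_univ _)
    calc t * ω (S R) ≤ t * ∑ i, ω (⋃ j ∈ s i, closedBall (P.c j) (P.r j)) := by
          gcongr
          exact (measure_mono hcov).trans (measure_iUnion_fintype_le _ _)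
      _ = ∑ i, t * ω (⋃ j ∈ s i, closedBall (P.c j) (P.r j)) := Finset.mul_sum _ _ _
      _ ≤ ∑ _i : Fin N, ν univ := Finset.sum_le_sum fun i _ => hone i
      _ = N * ν univ := by simp
  calc t * ω {x | ∃ ρ : ℝ, 0 < ρ ∧ t * ω (ball x ρ) < ν (ball x ρ)}
      ≤ t * ω (⋃ R, S R) := by gcongr
    _ = ⨆ R, t * ω (S R) := by rw [hmono.measure_iUnion, ENNReal.mul_iSup]
    _ ≤ _ := iSup_le hSR

/-- A Kolmogorov type inequality: weak `L¹` bounds control `L^θ` norms on sets of finite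
measure, for `0 < θ < 1`. -/
lemma exists_kolmogorov {θ : ℝ} (hθ0 : 0 < θ) (hθ1 : θ < 1) :
    ∃ C : ℝ≥0∞, C ≠ ⊤ ∧ ∀ {X : Type*} [MeasurableSpace X] (μ : Measure X) [IsFiniteMeasure μ]
      (G : X → ℝ≥0∞) (A : ℝ≥0∞), Measurable G → A ≠ ⊤ →
      (∀ t : ℝ≥0∞, t ≠ ⊤ → t * μ {x | t < G x} ≤ A) →
      ∫⁻ x, G x ^ θ ∂μ ≤ C * (A ^ θ * μ univ ^ (1 - θ)) := by
  have h2 : (2 : ℝ≥0∞) ^ (θ - 1) < 1 :=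
    ENNReal.rpow_lt_one_of_one_lt_of_neg (by norm_num) (by linarith)
  set c : ℝ≥0∞ := 2 ^ θ * (1 - 2 ^ (θ - 1))⁻¹ with hc
  have hctop : c ≠ ⊤ := ENNReal.mul_ne_top (ENNReal.rpow_ne_top_of_nonneg hθ0.le (by norm_num))
    (ENNReal.inv_ne_top.2 (tsub_pos_of_lt h2).ne')
  refine ⟨1 + c, by simp [hctop], ?_⟩
  intro X _ μ _ G A hG hA hw
  have hpt : ∀ a : ℝ≥0∞, a ≠ 0 → a ≠ ⊤ → ∀ x, G x ^ θ ≤ a ^ θ + ∑' k : ℕ,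
      {x | 2 ^ k * a < G x}.indicator (fun _ => (2 * (2 ^ k * a)) ^ θ) x := by
    intro a ha0 hat x
    by_cases hx : G x = ⊤
    · have : ∑' k : ℕ, {x | 2 ^ k * a < G x}.indicator (fun _ => (2 * (2 ^ k * a)) ^ θ) x = ⊤ := by
        refine top_le_iff.1 ?_
        have hb : a ^ θ ≠ 0 := by simp [ENNReal.rpow_eq_zero_iff, ha0, hat]
        rw [← ENNReal.tsum_const_eq_top_of_ne_zero (α := ℕ) hb]
        refine ENNReal.tsum_le_tsum fun k => ?_
        have hmem : x ∈ {x | 2 ^ k * a < G x} := by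
          rw [mem_ofPred_eq, hx]
          exact ENNReal.mul_lt_top (by simp) hat.lt_top
        rw [indicator_of_mem hmem]
        refine ENNReal.rpow_le_rpow ?_ hθ0.le
        rw [← mul_assoc, ← pow_succ']
        exact le_mul_of_one_le_left' (one_le_pow₀ (by norm_num))
      rw [this]; simp
    · have hex : ∃ k : ℕ, G x ≤ 2 ^ k * a := by
        obtain ⟨k, hk⟩ := ENNReal.exists_nat_mul_gt ha0 hx
        refine ⟨k, hk.le.trans ?_⟩
        gcongr
        exact_mod_cast Nat.lt_two_pow_self.le
      classical
      rcases hf : Nat.find hex with _ | k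
      · have := Nat.find_spec hex
        rw [hf] at this
        refine le_add_right (ENNReal.rpow_le_rpow (by simpa using this) hθ0.le)
      · have h1 := Nat.find_spec hex
        have h3 := Nat.find_min hex (m := k) (by omega)
        rw [hf] at h1
        refine le_add_left (le_trans ?_ (ENNReal.le_tsum k))
        rw [indicator_of_mem (by simpa using h3)]
        refine ENNReal.rpow_le_rpow ?_ hθ0.le
        rwa [← mul_assoc, ← pow_succ']
  have hmain : ∀ a : ℝ≥0∞, a ≠ 0 → a ≠ ⊤ →
      ∫⁻ x, G x ^ θ ∂μ ≤ a ^ θ * μ univ + c * (a ^ (θ - 1) * A) := by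
    intro a ha0 hat
    calc ∫⁻ x, G x ^ θ ∂μ ≤ ∫⁻ x, (a ^ θ + ∑' k : ℕ,
          {x | 2 ^ k * a < G x}.indicator (fun _ => (2 * (2 ^ k * a)) ^ θ) x) ∂μ :=
          lintegral_mono (hpt a ha0 hat)
      _ = a ^ θ * μ univ + ∑' k : ℕ, (2 * (2 ^ k * a)) ^ θ * μ {x | 2 ^ k * a < G x} := by
          rw [lintegral_add_left measurable_const, lintegral_const, lintegral_tsum]
          · congr 1
            refine tsum_congr fun k => ?_
            rw [lintegral_indicator_const (measurableSet_lt measurable_const hG)]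
          · intro k
            exact (measurable_const.indicator
              (measurableSet_lt measurable_const hG)).aemeasurable
      _ ≤ a ^ θ * μ univ + ∑' k : ℕ, 2 ^ θ * (a ^ (θ - 1) * A) * (2 ^ (θ - 1)) ^ k := by
          refine add_le_add le_rfl (ENNReal.tsum_le_tsum fun k => ?_)
          have hb0 : (2 ^ k * a : ℝ≥0∞) ≠ 0 := by simp [ha0]
          have hbt : (2 ^ k * a : ℝ≥0∞) ≠ ⊤ := ENNReal.mul_ne_top (by simp) hat
          calc (2 * (2 ^ k * a)) ^ θ * μ {x | 2 ^ k * a < G x}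
              = 2 ^ θ * (2 ^ k * a) ^ (θ - 1) *
                  ((2 ^ k * a) * μ {x | 2 ^ k * a < G x}) := by
                rw [ENNReal.mul_rpow_of_nonneg _ _ hθ0.le]
                conv_lhs => rw [show θ = θ - 1 + 1 by ring,
                  ENNReal.rpow_add (θ - 1) 1 hb0 hbt, ENNReal.rpow_one]
                rw [show θ - 1 + 1 = θ by ring]
                ring
            _ ≤ 2 ^ θ * (2 ^ k * a) ^ (θ - 1) * A := by gcongr; exact hw _ hbt
            _ = 2 ^ θ * (a ^ (θ - 1) * A) * (2 ^ (θ - 1)) ^ k := by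
                rw [ENNReal.mul_rpow_of_ne_top (by simp) hat, ← ENNReal.rpow_natCast,
                  ← ENNReal.rpow_natCast, ← ENNReal.rpow_mul, ← ENNReal.rpow_mul,
                  mul_comm (k : ℝ)]
                ring
      _ = _ := by
          rw [ENNReal.tsum_mul_left, ENNReal.tsum_geometric, hc]
          ring
  rcases eq_or_ne (μ univ) 0 with hm0 | hm0
  · rw [Measure.measure_univ_eq_zero] at hm0
    simp [hm0]
  have hmt : μ univ ≠ ⊤ := measure_ne_top _ _
  rcases eq_or_ne A 0 with hA0 | hA0
  · have : G =ᵐ[μ] 0 := by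
      have h0 : ∀ k : ℕ, μ {x | (1 / ((k : ℝ≥0∞) + 1)) < G x} = 0 := by
        intro k
        have := hw (1 / ((k : ℝ≥0∞) + 1)) (by simp)
        rw [hA0, nonpos_iff_eq_zero, mul_eq_zero] at this
        refine this.resolve_left ?_
        simp
      have h1 : ∀ᵐ x ∂μ, ∀ k : ℕ, ¬ (1 / ((k : ℝ≥0∞) + 1)) < G x :=
        ae_all_iff.2 fun k => by simpa only [ae_iff, not_not] using h0 k
      filter_upwards [h1] with x hx
      by_contra hne
      obtain ⟨k, hk⟩ := ENNReal.exists_inv_nat_lt hne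
      refine hx k (lt_of_le_of_lt ?_ hk)
      rw [one_div]
      exact ENNReal.inv_le_inv.2 (by simp)
    rw [lintegral_congr_ae (g := fun _ => 0)
      (this.mono fun x hx => by simp [hx, hθ0])]
    simp
  have ha0 : A / μ univ ≠ 0 := ENNReal.div_ne_zero.2 ⟨hA0, hmt⟩
  have hat : A / μ univ ≠ ⊤ := ENNReal.div_ne_top hA hm0
  refine (hmain (A / μ univ) ha0 hat).trans (le_of_eq ?_)
  have e1 : (A / μ univ) ^ θ * μ univ = A ^ θ * μ univ ^ (1 - θ) := by
    rw [ENNReal.div_rpow_of_nonneg _ _ hθ0.le, ENNReal.rpow_sub _ _ hm0 hmt, ENNReal.rpow_one,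
      div_eq_mul_inv, div_eq_mul_inv]
    ring
  have e2 : (A / μ univ) ^ (θ - 1) * A = A ^ θ * μ univ ^ (1 - θ) := by
    rw [← e1, ENNReal.rpow_sub _ _ ha0 hat, ENNReal.rpow_one, mul_comm, div_eq_mul_inv,
      ENNReal.inv_div (Or.inl hmt) (Or.inl hm0), mul_comm, mul_assoc]
    congr 1
    exact ENNReal.div_mul_cancel hA0 hA
  rw [e1, e2]
  ring

lemma measurable_radialWolff_ball {X : Type*} [PseudoMetricSpace X] [MeasurableSpace X]
    [OpensMeasurableSpace X] [SecondCountableTopology X] (s γ : ℝ) (ν : Measure X) [SFinite ν] :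
    Measurable fun x => radialWolff s γ fun ρ => ν (ball x ρ) := by
  have h1 : Measurable fun z : X × ℝ => ν (ball z.1 z.2) := by
    have hopen : IsOpen {w : (X × ℝ) × X | dist w.2 w.1.1 < w.1.2} :=
      isOpen_lt (by fun_prop) (by fun_prop)
    exact measurable_measure_prodMk_left (ν := ν) hopen.measurableSet
  have h2 : Measurable fun z : X × ℝ =>
      (ν (ball z.1 z.2) / ENNReal.ofReal (z.2 ^ γ)) ^ s / ENNReal.ofReal z.2 :=
    ((h1.div (by fun_prop)).pow_const _).div (by fun_prop)
  exact h2.lintegral_prod_right'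

lemma monotone_measure_ball {X : Type*} [PseudoMetricSpace X] [MeasurableSpace X]
    (ν : Measure X) (x : X) : Monotone fun ρ => ν (ball x ρ) :=
  fun _ _ h => measure_mono (ball_subset_ball h)

lemma radialWolff_ball_pos {X : Type*} [PseudoMetricSpace X] [MeasurableSpace X]
    {s γ : ℝ} (hs : 0 < s) (hγ : 0 ≤ γ) {ν : Measure X} (hν : ν ≠ 0) (x : X) :
    0 < radialWolff s γ fun ρ => ν (ball x ρ) := by
  obtain ⟨k, hk⟩ : ∃ k : ℕ, ν (ball x k) ≠ 0 := by
    by_contra! h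
    refine hν (Measure.measure_univ_eq_zero.1 ?_)
    rw [← iUnion_ball_nat x]
    exact measure_iUnion_null h
  have ht : (0 : ℝ) < k + 1 := by positivity
  refine lt_of_lt_of_le ?_ (le_radialWolff hs.le hγ (monotone_measure_ball ν x) ht)
  have : 0 < ν (ball x (k + 1)) :=
    (pos_iff_ne_zero.2 hk).trans_le (measure_mono (ball_subset_ball (by linarith)))
  refine ENNReal.div_pos (ENNReal.rpow_pos_of_nonneg ?_ hs.le).ne' (by norm_num)
  exact ENNReal.div_pos this.ne' ENNReal.ofReal_ne_top

lemma lintegral_wolffPot_le_embC {n : ℕ} {α p q : ℝ} (hp : 1 < p) (hq : 0 < q)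
    {σ : Measure (EuclideanSpace ℝ (Fin n))} {B : Set (EuclideanSpace ℝ (Fin n))}
    (hB : embC n α p q σ B ≠ ⊤) (ν : Measure (EuclideanSpace ℝ (Fin n))) [IsFiniteMeasure ν] :
    ∫⁻ y in B, wolffPot n α p ν y ^ q ∂σ ≤
      embC n α p q σ B ^ q * (ν univ) ^ (q * (1 / (p - 1))) := by
  have hs : 0 < 1 / (p - 1) := one_div_pos.2 (by linarith)
  have key : (∫⁻ y in B, wolffPot n α p ν y ^ q ∂σ) ^ (1 / q) ≤
      embC n α p q σ B * (ν univ) ^ (1 / (p - 1)) := by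
    have hne := hB
    unfold embC at hne ⊢
    set S := {κ : ℝ≥0∞ | ∀ ν : Measure (EuclideanSpace ℝ (Fin n)), IsFiniteMeasure ν →
      (∫⁻ y in B, wolffPot n α p ν y ^ q ∂σ) ^ (1 / q) ≤ κ * (ν Set.univ) ^ (1 / (p - 1))}
    rw [Ne, sInf_eq_top] at hne
    push Not at hne
    obtain ⟨κ, hκ, -⟩ := hne
    rcases eq_or_ne (ν univ) 0 with h0 | h0
    · have := hκ ν inferInstance
      rw [h0, ENNReal.zero_rpow_of_pos hs, mul_zero] at this
      exact this.trans (zero_le)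
    · have h1 : (ν univ) ^ (1 / (p - 1)) ≠ 0 := by
        simp [ENNReal.rpow_eq_zero_iff, h0]
      have h2 : (ν univ) ^ (1 / (p - 1)) ≠ ⊤ :=
        ENNReal.rpow_ne_top_of_nonneg hs.le (measure_ne_top _ _)
      rw [← ENNReal.div_le_iff h1 h2]
      refine le_sInf fun κ' hκ' => ?_
      rw [ENNReal.div_le_iff h1 h2]
      exact hκ' ν inferInstance
  have := ENNReal.rpow_le_rpow key hq.le
  rwa [← ENNReal.rpow_mul, one_div_mul_cancel hq.ne', ENNReal.rpow_one,
    ENNReal.mul_rpow_of_nonneg _ _ hq.le, ← ENNReal.rpow_mul, mul_comm (1 / (p - 1))] at this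

lemma embC_mono (n : ℕ) (α p q : ℝ) (hq : 0 < q) (σ : Measure (EuclideanSpace ℝ (Fin n)))
    {E F : Set (EuclideanSpace ℝ (Fin n))} (h : E ⊆ F) :
    embC n α p q σ E ≤ embC n α p q σ F := by
  refine sInf_le_sInf fun κ hκ ν hν => ?_
  refine le_trans ?_ (hκ ν hν)
  exact ENNReal.rpow_le_rpow (lintegral_mono_set h) (by positivity)

lemma monotone_embC_ball (n : ℕ) (α p q : ℝ) (hq : 0 < q)
    (σ : Measure (EuclideanSpace ℝ (Fin n))) (x : EuclideanSpace ℝ (Fin n)) :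
    Monotone fun ρ => embC n α p q σ (ball x ρ) :=
  fun _ _ h => embC_mono n α p q hq σ (ball_subset_ball h)

lemma exists_embC_rpow_le_of_isSolution {n : ℕ} {α p q : ℝ} (hp : 1 < p) (hq0 : 0 < q)
    (hqp : q < p - 1) (hγ : 0 ≤ (n : ℝ) - α * p)
    {σ : Measure (EuclideanSpace ℝ (Fin n))} [IsLocallyFiniteMeasure σ]
    {u : EuclideanSpace ℝ (Fin n) → ℝ≥0∞} (hu : IsSolution n α p q σ u)
    (hpos : ∀ᵐ x ∂(volume : Measure (EuclideanSpace ℝ (Fin n))), 0 < u x) :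
    ∃ C : ℝ≥0∞, C ≠ ⊤ ∧ ∀ x ρ, 0 < ρ →
      embC n α p q σ (ball x ρ) ^ (q * (p - 1) / (p - 1 - q)) ≤
        C * (σ.withDensity fun y => u y ^ q) (ball x ρ) := by
  obtain ⟨hum, hloc, hσeq, hveq⟩ := hu
  have hp1 : 0 < p - 1 := by linarith
  have hs : 0 < 1 / (p - 1) := one_div_pos.2 hp1
  set ω := σ.withDensity fun y => u y ^ q with hω
  have hω0 : ω ≠ 0 := by
    intro h0
    have : ∀ᵐ x ∂(volume : Measure (EuclideanSpace ℝ (Fin n))), False := by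
      filter_upwards [hpos, hveq] with x h1 h2
      rw [h2, h0] at h1
      simp [wolffPot] at h1
      exact absurd h1 (by simp [hp1])
    rw [Filter.eventually_false_iff_eq_bot, ae_eq_bot] at this
    exact (NeZero.ne _) this
  have hWpos : ∀ x, wolffPot n α p ω x ≠ 0 := fun x => (radialWolff_ball_pos hs hγ hω0 x).ne'
  have hufin : ∀ᵐ x ∂σ, u x ≠ ⊤ := by
    have : ∀ k : ℕ, ∀ᵐ x ∂σ, x ∈ ball (0 : EuclideanSpace ℝ (Fin n)) (k + 1) → u x ≠ ⊤ := by
      intro k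
      rw [← ae_restrict_iff' measurableSet_ball]
      have h1 := hloc 0 (k + 1) (by positivity)
      filter_upwards [ae_lt_top (hum.pow_const q) h1.ne] with x hx h
      rw [h, ENNReal.top_rpow_of_pos hq0] at hx
      exact lt_irrefl _ hx
    filter_upwards [ae_all_iff.2 this] with x hx
    obtain ⟨k, hk⟩ := exists_nat_gt (dist x 0)
    exact hx k (by rw [mem_ball]; linarith)
  obtain ⟨N, hN⟩ := exists_weakType_centered (EuclideanSpace ℝ (Fin n))
  set θ : ℝ := q * (1 / (p - 1)) with hθ
  have hθ0 : 0 < θ := by positivity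
  have hθ1 : θ < 1 := by
    rw [hθ, mul_one_div, div_lt_one hp1]; exact hqp
  obtain ⟨C, hC, hkol⟩ := exists_kolmogorov hθ0 hθ1
  have hWm : ∀ ν : Measure (EuclideanSpace ℝ (Fin n)), SFinite ν →
      Measurable (wolffPot n α p ν) := fun ν _ => measurable_radialWolff_ball _ _ ν
  set D : ℝ≥0∞ := (C * (N : ℝ≥0∞) ^ θ) ^ (1 / q) with hD
  have hDtop : D ≠ ⊤ := ENNReal.rpow_ne_top_of_nonneg (by positivity)
    (ENNReal.mul_ne_top hC (ENNReal.rpow_ne_top_of_nonneg hθ0.le (by simp)))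
  have hemb : ∀ x ρ, 0 < ρ →
      embC n α p q σ (ball x ρ) ≤ D * ω (ball x ρ) ^ ((1 - θ) / q) := by
    intro x ρ hρ
    refine sInf_le fun ν hν => ?_
    set R : EuclideanSpace ℝ (Fin n) → ℝ≥0∞ := fun y => wolffPot n α p ν y / wolffPot n α p ω y
    have hRm : Measurable R := (hWm ν inferInstance).div (hWm ω inferInstance)
    have hfin : IsFiniteMeasure (ω.restrict (ball x ρ)) := by
      refine ⟨?_⟩
      rw [Measure.restrict_apply_univ, hω, withDensity_apply _ measurableSet_ball]
      exact hloc x ρ hρ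
    have hweak : ∀ t : ℝ≥0∞, t ≠ ⊤ →
        t * (ω.restrict (ball x ρ)) {y | t < R y ^ (p - 1)} ≤ N * ν univ := by
      intro t ht
      refine le_trans (mul_le_mul' le_rfl ?_) (hN ω ν t)
      refine (Measure.restrict_apply_le _ _).trans (measure_mono fun y hy => ?_)
      by_contra hcon
      simp only [mem_ofPred_eq, not_exists, not_and, not_lt] at hcon hy
      have h1 : wolffPot n α p ν y ≤ t ^ (1 / (p - 1)) * wolffPot n α p ω y := by
        refine le_trans (radialWolff_mono hs.le hcon) ?_
        rw [radialWolff_const_mul hs.le ht]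
        rfl
      have h2 : R y ≤ t ^ (1 / (p - 1)) := ENNReal.div_le_of_le_mul h1
      have h3 := ENNReal.rpow_le_rpow h2 hp1.le
      rw [← ENNReal.rpow_mul, one_div_mul_cancel hp1.ne', ENNReal.rpow_one] at h3
      exact absurd hy (not_lt.2 h3)
    have h1 := hkol (ω.restrict (ball x ρ)) (fun y => R y ^ (p - 1)) (N * ν univ)
      (hRm.pow_const _) (ENNReal.mul_ne_top (by simp) (measure_ne_top _ _)) hweak
    have h2 : ∫⁻ y in ball x ρ, wolffPot n α p ν y ^ q ∂σ ≤
        ∫⁻ y in ball x ρ, (R y ^ (p - 1)) ^ θ ∂ω := by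
      rw [hω, restrict_withDensity measurableSet_ball,
        lintegral_withDensity_eq_lintegral_mul _ (hum.pow_const q)
          ((hRm.pow_const _).pow_const _)]
      refine lintegral_mono_ae (ae_restrict_of_ae ?_)
      filter_upwards [hσeq, hufin] with y hy1 hy2
      rw [Pi.mul_apply, ← ENNReal.rpow_mul, show (p - 1) * θ = q by rw [hθ]; field_simp,
        ← ENNReal.mul_rpow_of_nonneg _ _ hq0.le]
      refine ENNReal.rpow_le_rpow ?_ hq0.le
      rw [mul_comm]
      simp only [R]
      rw [hy1] at hy2 ⊢
      rw [ENNReal.div_mul_cancel (hWpos y) hy2]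
    calc (∫⁻ y in ball x ρ, wolffPot n α p ν y ^ q ∂σ) ^ (1 / q)
        ≤ (C * ((N * ν univ) ^ θ * ω (ball x ρ) ^ (1 - θ))) ^ (1 / q) := by
          refine ENNReal.rpow_le_rpow ?_ (by positivity)
          simpa using h2.trans h1
      _ = D * ω (ball x ρ) ^ ((1 - θ) / q) * ν univ ^ (1 / (p - 1)) := by
          have hq' : (0 : ℝ) ≤ 1 / q := by positivity
          rw [ENNReal.mul_rpow_of_nonneg _ _ hθ0.le, ← mul_assoc, ← mul_assoc,
            mul_right_comm, ENNReal.mul_rpow_of_nonneg _ _ hq', ENNReal.mul_rpow_of_nonneg _ _ hq',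
            ← ENNReal.rpow_mul (ω (ball x ρ)), ← ENNReal.rpow_mul (ν univ), mul_one_div, mul_one_div,
            show θ / q = 1 / (p - 1) by rw [hθ]; field_simp]
  refine ⟨D ^ (q * (p - 1) / (p - 1 - q)), ENNReal.rpow_ne_top_of_nonneg ?_ hDtop, ?_⟩
  · have : 0 < p - 1 - q := by linarith
    positivity
  intro x ρ hρ
  have hpq : 0 < p - 1 - q := by linarith
  have he : 0 ≤ q * (p - 1) / (p - 1 - q) := by positivity
  have h1 := ENNReal.rpow_le_rpow (hemb x ρ hρ) he
  rwa [ENNReal.mul_rpow_of_nonneg _ _ he, ← ENNReal.rpow_mul (ω _),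
    show (1 - θ) / q * (q * (p - 1) / (p - 1 - q)) = 1 by rw [hθ]; field_simp,
    ENNReal.rpow_one] at h1

lemma lintegral_intK_rpow_lt_top_of_isSolution {n : ℕ} {α p q r : ℝ} (hp : 1 < p) (hq0 : 0 < q)
    (hqp : q < p - 1) (hγ : 0 ≤ (n : ℝ) - α * p) (hr : 0 ≤ r)
    {σ : Measure (EuclideanSpace ℝ (Fin n))} [IsLocallyFiniteMeasure σ]
    {u : EuclideanSpace ℝ (Fin n) → ℝ≥0∞} (hu : IsSolution n α p q σ u)
    (hpos : ∀ᵐ x ∂(volume : Measure (EuclideanSpace ℝ (Fin n))), 0 < u x)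
    (hur : ∫⁻ x, u x ^ r < ⊤) : ∫⁻ x, intK n α p q σ x ^ r < ⊤ := by
  obtain ⟨C, hC, hemb⟩ := exists_embC_rpow_le_of_isSolution hp hq0 hqp hγ hu hpos
  have hs : 0 ≤ 1 / (p - 1) := one_div_nonneg.2 (by linarith)
  have hK : ∀ᵐ x ∂(volume : Measure (EuclideanSpace ℝ (Fin n))),
      intK n α p q σ x ^ r ≤ (C ^ (1 / (p - 1))) ^ r * u x ^ r := by
    filter_upwards [hu.2.2.2] with x hx
    rw [← ENNReal.mul_rpow_of_nonneg _ _ hr, hx]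
    refine ENNReal.rpow_le_rpow ?_ hr
    refine (radialWolff_mono hs fun ρ hρ => hemb x ρ hρ).trans ?_
    rw [radialWolff_const_mul hs hC]
    rfl
  have hCt : (C ^ (1 / (p - 1))) ^ r ≠ ⊤ :=
    ENNReal.rpow_ne_top_of_nonneg hr (ENNReal.rpow_ne_top_of_nonneg hs hC)
  refine (lintegral_mono_ae hK).trans_lt ?_
  rw [lintegral_const_mul' _ _ hCt]
  exact ENNReal.mul_lt_top hCt.lt_top hur

lemma ennreal_add_rpow_le {q : ℝ} (hq : 0 ≤ q) (a b : ℝ≥0∞) :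
    (a + b) ^ q ≤ 2 ^ q * (a ^ q + b ^ q) := by
  have h1 : a + b ≤ 2 * max a b := by
    rw [two_mul]; exact add_le_add (le_max_left _ _) (le_max_right _ _)
  calc (a + b) ^ q ≤ (2 * max a b) ^ q := ENNReal.rpow_le_rpow h1 hq
    _ = 2 ^ q * max a b ^ q := ENNReal.mul_rpow_of_nonneg _ _ hq
    _ ≤ 2 ^ q * (a ^ q + b ^ q) := by
        gcongr
        rcases max_choice a b with h | h <;> rw [h]
        · exact le_self_add
        · exact le_add_self

lemma radialWolff_le_add_of_or {s γ : ℝ} (hs : 0 ≤ s) {m m₁ m₂ : ℝ → ℝ≥0∞}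
    (hm₂ : Measurable m₂) (h : ∀ ρ, 0 < ρ → m ρ ≤ m₁ ρ ∨ m ρ ≤ m₂ ρ) :
    radialWolff s γ m ≤ radialWolff s γ m₁ + radialWolff s γ m₂ := by
  unfold radialWolff
  rw [← lintegral_add_right _ (measurable_radialWolff_integrand s γ hm₂)]
  refine setLIntegral_mono' measurableSet_Ioi fun ρ hρ => ?_
  rcases h ρ hρ with h | h
  · refine le_add_right ?_
    gcongr
  · refine le_add_left ?_
    gcongr

lemma radialWolff_add_le {s γ : ℝ} (hs : 0 ≤ s) (m₁ : ℝ → ℝ≥0∞) {m₂ : ℝ → ℝ≥0∞}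
    (hm₂ : Measurable m₂) :
    radialWolff s γ (fun ρ => m₁ ρ + m₂ ρ) ≤
      2 ^ s * (radialWolff s γ m₁ + radialWolff s γ m₂) := by
  unfold radialWolff
  rw [← lintegral_add_right _ (measurable_radialWolff_integrand s γ hm₂),
    ← lintegral_const_mul' _ _ (ENNReal.rpow_ne_top_of_nonneg hs (by norm_num))]
  refine lintegral_mono fun ρ => ?_
  rw [← ENNReal.add_div, ← mul_div_assoc, ENNReal.add_div]
  gcongr
  exact ennreal_add_rpow_le hs _ _

lemma radialWolff_holder {s γ θ : ℝ} (hs : 0 ≤ s) (hθ0 : 0 ≤ θ) (hθ1 : θ ≤ 1)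
    {k l : ℝ → ℝ≥0∞} (hk : Measurable k) (hl : Measurable l) :
    radialWolff s γ (fun ρ => k ρ ^ (1 - θ) * l ρ ^ θ) ≤
      radialWolff s γ k ^ (1 - θ) * radialWolff s γ l ^ θ := by
  have hθ : 0 ≤ 1 - θ := by linarith
  refine le_trans (le_of_eq ?_) (ENNReal.lintegral_mul_norm_pow_le
    (measurable_radialWolff_integrand s γ hk).aemeasurable
    (measurable_radialWolff_integrand s γ hl).aemeasurable hθ hθ0 (by ring))
  refine setLIntegral_congr_fun measurableSet_Ioi fun ρ hρ => ?_
  have hsplit : ∀ a b T : ℝ≥0∞, T ≠ 0 → T ≠ ⊤ →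
      (a / T) ^ (1 - θ) * (b / T) ^ θ = a ^ (1 - θ) * b ^ θ / T := by
    intro a b T h0 ht
    rw [ENNReal.div_rpow_of_nonneg _ _ hθ, ENNReal.div_rpow_of_nonneg _ _ hθ0,
      div_eq_mul_inv, div_eq_mul_inv, div_eq_mul_inv, mul_mul_mul_comm, ← ENNReal.inv_rpow,
      ← ENNReal.inv_rpow, ← ENNReal.rpow_add _ _ (by simpa using ht) (by simpa using h0)]
    simp
  have hρ : (0 : ℝ) < ρ := hρ
  have hργ : 0 < ρ ^ γ := by positivity
  simp only
  rw [hsplit _ _ _ (by simpa using hρ) ENNReal.ofReal_ne_top, ← ENNReal.rpow_mul,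
    ← ENNReal.rpow_mul, mul_comm s, mul_comm s, ENNReal.rpow_mul, ENNReal.rpow_mul,
    ← ENNReal.mul_rpow_of_nonneg _ _ hs, hsplit _ _ _ (by simpa using hργ) ENNReal.ofReal_ne_top]

lemma exists_wolffPot_le_intK_add {n : ℕ} {α p q : ℝ} (hp : 1 < p) (hq0 : 0 < q)
    (hqp : q < p - 1) :
    ∃ C : ℝ≥0∞, C ≠ ⊤ ∧ ∀ (σ ω : Measure (EuclideanSpace ℝ (Fin n))),
      IsFiniteMeasure ω → (∀ x t, embC n α p q σ (ball x t) ≠ ⊤) →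
      (∀ x t, 0 < t → ω (ball x t) ≤ ∫⁻ y in ball x t, wolffPot n α p ω y ^ q ∂σ) →
      ∀ x, wolffPot n α p ω x ≠ ⊤ →
        wolffPot n α p ω x ≤
          C * (intK n α p q σ x + wolffPot n α p σ x ^ ((p - 1) / (p - 1 - q))) := by
  have hp1 : 0 < p - 1 := by linarith
  have hpq : 0 < p - 1 - q := by linarith
  have hs : 0 ≤ 1 / (p - 1) := one_div_nonneg.2 hp1.le
  set s : ℝ := 1 / (p - 1) with hsdef
  set γ : ℝ := (n : ℝ) - α * p with hγ
  set θ : ℝ := q * s with hθ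
  have hθ0 : 0 ≤ θ := by positivity
  have hθ1 : θ < 1 := by
    rw [hθ, hsdef, mul_one_div, div_lt_one hp1]; exact hqp
  have h1θ : 0 < 1 - θ := by linarith
  have hβ : (p - 1) / (p - 1 - q) = 1 / (1 - θ) := by
    rw [hθ, hsdef]; field_simp
  set c₁ : ℝ≥0∞ := ENNReal.ofReal (2 ^ γ) ^ s with hc₁
  have hc₁t : c₁ ≠ ⊤ := ENNReal.rpow_ne_top_of_nonneg hs ENNReal.ofReal_ne_top
  set A : ℝ≥0∞ := 2 ^ s * ((2 ^ q) ^ s * c₁ ^ θ + (2 ^ q * c₁ ^ q) ^ s) with hA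
  have hAt : A ≠ ⊤ := by
    have h2 : ∀ z : ℝ, 0 ≤ z → (2 : ℝ≥0∞) ^ z ≠ ⊤ := fun z hz =>
      ENNReal.rpow_ne_top_of_nonneg hz (by norm_num)
    refine ENNReal.mul_ne_top (h2 _ hs) (ENNReal.add_ne_top.2 ⟨ENNReal.mul_ne_top
      (ENNReal.rpow_ne_top_of_nonneg hs (h2 _ hq0.le)) (ENNReal.rpow_ne_top_of_nonneg hθ0 hc₁t),
      ENNReal.rpow_ne_top_of_nonneg hs (ENNReal.mul_ne_top (h2 _ hq0.le)
        (ENNReal.rpow_ne_top_of_nonneg hq0.le hc₁t))⟩)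
  have hβ0 : 0 ≤ 1 / (1 - θ) := by positivity
  refine ⟨A ^ (1 / (1 - θ)) * 2 ^ (1 / (1 - θ)), ENNReal.mul_ne_top
    (ENNReal.rpow_ne_top_of_nonneg hβ0 hAt) (ENNReal.rpow_ne_top_of_nonneg hβ0 (by norm_num)), ?_⟩
  intro σ ω hωfin hκ hω x hx
  set w := wolffPot n α p ω x with hw
  have hdil : radialWolff s γ (fun ρ => ω (ball x (2 * ρ))) = c₁ * w :=
    radialWolff_comp_two_mul γ hs fun ρ => ω (ball x ρ)
  have hmeas2 : Measurable fun ρ => ω (ball x (2 * ρ)) :=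
    (monotone_measure_ball ω x).measurable.comp (measurable_const_mul 2)
  have hnear : ∀ t, 0 < t → ∀ y ∈ ball x t, wolffPot n α p ω y ≤
      wolffPot n α p (ω.restrict (ball x (2 * t))) y + c₁ * w := by
    intro t ht y hy
    rw [← hdil]
    refine radialWolff_le_add_of_or hs hmeas2 fun ρ hρ => ?_
    rw [mem_ball] at hy
    rcases lt_or_ge ρ t with h | h
    · left
      rw [Measure.restrict_eq_self]
      exact ball_subset_ball' (by linarith)
    · right
      exact measure_mono (ball_subset_ball' (by linarith))
  have hball : ∀ t, 0 < t → ω (ball x t) ≤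
      2 ^ q * (embC n α p q σ (ball x t) ^ q * ω (ball x (2 * t)) ^ θ) +
        2 ^ q * (c₁ * w) ^ q * σ (ball x t) := by
    intro t ht
    have h2 : (2 : ℝ≥0∞) ^ q ≠ ⊤ := ENNReal.rpow_ne_top_of_nonneg hq0.le (by norm_num)
    calc ω (ball x t) ≤ ∫⁻ y in ball x t, wolffPot n α p ω y ^ q ∂σ := hω x t ht
      _ ≤ ∫⁻ y in ball x t, 2 ^ q * (wolffPot n α p (ω.restrict (ball x (2 * t))) y ^ q +
            (c₁ * w) ^ q) ∂σ := by
          refine setLIntegral_mono' measurableSet_ball fun y hy => ?_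
          exact (ENNReal.rpow_le_rpow (hnear t ht y hy) hq0.le).trans
            (ennreal_add_rpow_le hq0.le _ _)
      _ = 2 ^ q * (∫⁻ y in ball x t, wolffPot n α p (ω.restrict (ball x (2 * t))) y ^ q ∂σ) +
            2 ^ q * (c₁ * w) ^ q * σ (ball x t) := by
          rw [lintegral_const_mul' _ _ h2, lintegral_add_right _ measurable_const,
            setLIntegral_const, mul_add, mul_assoc]
      _ ≤ _ := by
          gcongr
          refine (lintegral_wolffPot_le_embC hp hq0 (hκ x t) _).trans ?_
          rw [Measure.restrict_apply_univ]
  have hmain : w ≤ A * (intK n α p q σ x ^ (1 - θ) + wolffPot n α p σ x) * w ^ θ := by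
    have hκm : Measurable fun ρ => embC n α p q σ (ball x ρ) ^ (q * (p - 1) / (p - 1 - q)) :=
      (monotone_embC_ball n α p q hq0 σ x).measurable.pow_const _
    have e1 : ∀ t, embC n α p q σ (ball x t) ^ q =
        (embC n α p q σ (ball x t) ^ (q * (p - 1) / (p - 1 - q))) ^ (1 - θ) := by
      intro t
      rw [← ENNReal.rpow_mul]
      congr 1
      rw [hθ, hsdef]; field_simp
    have h1 : w ≤ 2 ^ s * (radialWolff s γ (fun t => 2 ^ q *
        (embC n α p q σ (ball x t) ^ q * ω (ball x (2 * t)) ^ θ)) +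
        radialWolff s γ (fun t => 2 ^ q * (c₁ * w) ^ q * σ (ball x t))) :=
      (radialWolff_mono hs hball).trans
        (radialWolff_add_le hs _ ((monotone_measure_ball σ x).measurable.const_mul _))
    refine h1.trans ?_
    have h2 : (2 : ℝ≥0∞) ^ q ≠ ⊤ := ENNReal.rpow_ne_top_of_nonneg hq0.le (by norm_num)
    have h3 : 2 ^ q * (c₁ * w) ^ q ≠ ⊤ :=
      ENNReal.mul_ne_top h2 (ENNReal.rpow_ne_top_of_nonneg hq0.le (ENNReal.mul_ne_top hc₁t hx))
    rw [radialWolff_const_mul hs h2, radialWolff_const_mul hs h3]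
    have h4 : radialWolff s γ (fun t => embC n α p q σ (ball x t) ^ q * ω (ball x (2 * t)) ^ θ) ≤
        intK n α p q σ x ^ (1 - θ) * (c₁ * w) ^ θ := by
      simp_rw [e1]
      refine (radialWolff_holder hs hθ0 hθ1.le hκm hmeas2).trans (le_of_eq ?_)
      rw [hdil]
      rfl
    have h5 : (2 ^ q * (c₁ * w) ^ q) ^ s = (2 ^ q * c₁ ^ q) ^ s * w ^ θ := by
      rw [ENNReal.mul_rpow_of_nonneg _ _ hq0.le, ← mul_assoc, ENNReal.mul_rpow_of_nonneg _ _ hs,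
        ← ENNReal.rpow_mul w]
    rw [ENNReal.mul_rpow_of_nonneg _ _ hθ0] at h4
    rw [h5]
    change 2 ^ s * (_ + _ * wolffPot n α p σ x) ≤ _
    calc _ ≤ 2 ^ s * ((2 ^ q) ^ s * (intK n α p q σ x ^ (1 - θ) * (c₁ ^ θ * w ^ θ)) +
          (2 ^ q * c₁ ^ q) ^ s * w ^ θ * wolffPot n α p σ x) := by gcongr
      _ = 2 ^ s * ((2 ^ q) ^ s * c₁ ^ θ * intK n α p q σ x ^ (1 - θ) +
          (2 ^ q * c₁ ^ q) ^ s * wolffPot n α p σ x) * w ^ θ := by ring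
      _ ≤ _ := by
          rw [hA, mul_assoc (2 ^ s) (_ + _) (_ + _)]
          gcongr
          rw [add_mul, mul_add, mul_add]
          refine add_le_add le_self_add le_add_self
  rcases eq_or_ne w 0 with h0 | h0
  · rw [h0]; exact zero_le
  have hwθ0 : w ^ θ ≠ 0 := by
    simp [ENNReal.rpow_eq_zero_iff, h0, hx]
  have hwθt : w ^ θ ≠ ⊤ := ENNReal.rpow_ne_top_of_nonneg hθ0 hx
  have h6 : w ^ (1 - θ) ≤ A * (intK n α p q σ x ^ (1 - θ) + wolffPot n α p σ x) := by
    rw [ENNReal.rpow_sub _ _ h0 hx, ENNReal.rpow_one]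
    exact ENNReal.div_le_of_le_mul hmain
  have h7 := ENNReal.rpow_le_rpow h6 hβ0
  rw [← ENNReal.rpow_mul, mul_one_div_cancel h1θ.ne', ENNReal.rpow_one,
    ENNReal.mul_rpow_of_nonneg _ _ hβ0] at h7
  refine h7.trans ?_
  rw [mul_assoc, hβ]
  gcongr
  refine (ennreal_add_rpow_le hβ0 _ _).trans ?_
  rw [← ENNReal.rpow_mul, mul_one_div_cancel h1θ.ne', ENNReal.rpow_one]

lemma exists_measure_ball_le_intK {n : ℕ} {α p q : ℝ} (hp : 1 < p) (hq0 : 0 < q)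
    (hqp : q < p - 1) (hγ : 0 ≤ (n : ℝ) - α * p) :
    ∃ C : ℝ≥0∞, C ≠ ⊤ ∧ ∀ (σ : Measure (EuclideanSpace ℝ (Fin n))) x t, 0 < t →
      (σ (ball x t) / ENNReal.ofReal (t ^ ((n : ℝ) - α * p))) ^ (1 / (p - 1)) ≤
        C * intK n α p q σ x ^ ((p - 1 - q) / (p - 1)) := by
  have hp1 : 0 < p - 1 := by linarith
  have hpq : 0 < p - 1 - q := by linarith
  have hs : 0 ≤ 1 / (p - 1) := one_div_nonneg.2 hp1.le
  set s : ℝ := 1 / (p - 1) with hsdef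
  set γ : ℝ := (n : ℝ) - α * p with hγdef
  set η : ℝ := (p - 1 - q) / (p - 1) with hη
  set e : ℝ := q * (p - 1) / (p - 1 - q) with he
  have he0 : 0 ≤ e := by positivity
  have hη0 : 0 ≤ η := by positivity
  refine ⟨ENNReal.ofReal (2 ^ γ) ^ s * 2, ENNReal.mul_ne_top
    (ENNReal.rpow_ne_top_of_nonneg hs ENNReal.ofReal_ne_top) (by norm_num), ?_⟩
  intro σ x t ht
  set κ := embC n α p q σ (ball x t) with hκ
  set T := ENNReal.ofReal ((2 * t) ^ γ) with hT
  have hT0 : T ≠ 0 := by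
    have : 0 < (2 * t) ^ γ := by positivity
    simpa [hT] using this
  have hTt : T ≠ ⊤ := ENNReal.ofReal_ne_top
  have h1 : σ (ball x t) ^ (1 / q) * ((1 / T) ^ s / 2) ≤ κ := by
    refine le_sInf fun κ' hκ' => ?_
    have h2 := hκ' (Measure.dirac x) inferInstance
    rw [measure_univ, ENNReal.one_rpow, mul_one] at h2
    refine le_trans ?_ h2
    have h3 : ∀ y ∈ ball x t, ((1 / T) ^ s / 2) ^ q ≤ wolffPot n α p (Measure.dirac x) y ^ q := by
      intro y hy
      refine ENNReal.rpow_le_rpow ?_ hq0.le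
      refine le_trans (le_of_eq ?_)
        (le_radialWolff hs hγ (monotone_measure_ball (Measure.dirac x) y) ht)
      rw [Measure.dirac_apply_of_mem (mem_ball_comm.1 hy)]
    calc σ (ball x t) ^ (1 / q) * ((1 / T) ^ s / 2)
        = (((1 / T) ^ s / 2) ^ q * σ (ball x t)) ^ (1 / q) := by
          rw [ENNReal.mul_rpow_of_nonneg _ _ (by positivity), ← ENNReal.rpow_mul,
            mul_one_div_cancel hq0.ne', ENNReal.rpow_one, mul_comm]
      _ = (∫⁻ _ in ball x t, ((1 / T) ^ s / 2) ^ q ∂σ) ^ (1 / q) := by rw [setLIntegral_const]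
      _ ≤ _ := ENNReal.rpow_le_rpow (setLIntegral_mono' measurableSet_ball h3) (by positivity)
  have h2 : (κ ^ e / T) ^ s / 2 ≤ intK n α p q σ x :=
    le_radialWolff (m := fun ρ => embC n α p q σ (ball x ρ) ^ e) hs hγ
      (fun a b hab => ENNReal.rpow_le_rpow (monotone_embC_ball n α p q hq0 σ x hab) he0) ht
  have h3 : (σ (ball x t) / T) ^ s / 2 ≤ intK n α p q σ x ^ η := by
    refine le_trans ?_ (ENNReal.rpow_le_rpow h2 hη0)
    have h4 := ENNReal.rpow_le_rpow h1 (show 0 ≤ q * s by positivity)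
    have e1 : ((κ ^ e / T) ^ s / 2) ^ η = κ ^ (q * s) * ((T⁻¹) ^ (s * η) * (2⁻¹) ^ η) := by
      rw [div_eq_mul_inv, div_eq_mul_inv, ENNReal.mul_rpow_of_nonneg _ _ hs,
        ENNReal.mul_rpow_of_nonneg _ _ hη0, ENNReal.mul_rpow_of_nonneg _ _ hη0,
        ← ENNReal.rpow_mul, ← ENNReal.rpow_mul, ← ENNReal.rpow_mul, mul_assoc,
        show e * (s * η) = q * s by rw [he, hη, hsdef]; field_simp]
    have e2 : (σ (ball x t) ^ (1 / q) * ((1 / T) ^ s / 2)) ^ (q * s) =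
        σ (ball x t) ^ s * ((T⁻¹) ^ (s * (q * s)) * (2⁻¹) ^ (q * s)) := by
      rw [one_div T, div_eq_mul_inv ((T⁻¹) ^ s), ENNReal.mul_rpow_of_nonneg _ _ (by positivity),
        ENNReal.mul_rpow_of_nonneg _ _ (by positivity), ← ENNReal.rpow_mul, ← ENNReal.rpow_mul,
        show 1 / q * (q * s) = s by field_simp]
    rw [e1]
    rw [e2] at h4
    have hsum : q * s + η = 1 := by rw [hη, hsdef]; field_simp; ring
    calc (σ (ball x t) / T) ^ s / 2
        = σ (ball x t) ^ s * ((T⁻¹) ^ (s * (q * s)) * (2⁻¹) ^ (q * s)) *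
            ((T⁻¹) ^ (s * η) * (2⁻¹) ^ η) := by
          have a1 : (T⁻¹) ^ s = (T⁻¹) ^ (s * (q * s)) * (T⁻¹) ^ (s * η) := by
            rw [← ENNReal.rpow_add _ _ (by simpa using hTt) (by simpa using hT0), ← mul_add,
              hsum, mul_one]
          have a2 : (2⁻¹ : ℝ≥0∞) = (2⁻¹) ^ (q * s) * (2⁻¹) ^ η := by
            rw [← ENNReal.rpow_add _ _ (by simp) (by simp), hsum, ENNReal.rpow_one]
          rw [div_eq_mul_inv, div_eq_mul_inv, ENNReal.mul_rpow_of_nonneg _ _ hs, a1]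
          conv_lhs => rw [a2]
          ring
      _ ≤ _ := by gcongr
  have h2γ : (0 : ℝ) < 2 ^ γ := by positivity
  have e3 : σ (ball x t) / ENNReal.ofReal (t ^ γ) =
      ENNReal.ofReal (2 ^ γ) * (σ (ball x t) / T) := by
    rw [hT, Real.mul_rpow (by norm_num) ht.le, ENNReal.ofReal_mul h2γ.le, ← mul_div_assoc,
      ENNReal.mul_div_mul_left _ _ (by simpa using h2γ) ENNReal.ofReal_ne_top]
  rw [e3, ENNReal.mul_rpow_of_nonneg _ _ hs, mul_assoc]
  gcongr
  rwa [ENNReal.div_le_iff (by norm_num) (by norm_num), mul_comm] at h3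

lemma ofReal_rpow_div_rpow_div {s γ a ρ : ℝ} (hρ : 0 < ρ) :
    (ENNReal.ofReal (ρ ^ a) / ENNReal.ofReal (ρ ^ γ)) ^ s / ENNReal.ofReal ρ =
      ENNReal.ofReal (ρ ^ ((a - γ) * s - 1)) := by
  rw [← ENNReal.ofReal_div_of_pos (by positivity), ENNReal.ofReal_rpow_of_pos (by positivity),
    ← ENNReal.ofReal_div_of_pos hρ, ← Real.rpow_sub hρ, ← Real.rpow_mul hρ.le,
    Real.rpow_sub_one hρ.ne']

lemma ae_radialWolff_ball_lt_top {n : ℕ} {s γ : ℝ} (hs : 0 < s) (hγ0 : 0 < γ) (hγn : γ < n)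
    (ν : Measure (EuclideanSpace ℝ (Fin n))) [IsFiniteMeasure ν] :
    ∀ᵐ x ∂(volume : Measure (EuclideanSpace ℝ (Fin n))),
      radialWolff s γ (fun ρ => ν (ball x ρ)) < ⊤ := by
  filter_upwards [Besicovitch.ae_tendsto_rnDeriv ν
    (volume : Measure (EuclideanSpace ℝ (Fin n))),
    Measure.rnDeriv_lt_top ν (volume : Measure (EuclideanSpace ℝ (Fin n)))] with x hx hfin
  obtain ⟨L, hL1, hL2⟩ := exists_between hfin
  have hev := hx.eventually (gt_mem_nhds hL1)
  rw [eventually_nhdsWithin_iff, Metric.eventually_nhds_iff] at hev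
  obtain ⟨δ, hδ, hev⟩ := hev
  set c := L * volume (ball (0 : EuclideanSpace ℝ (Fin n)) 1) with hc
  have hct : c ≠ ⊤ := ENNReal.mul_ne_top hL2.ne measure_ball_lt_top.ne
  have hsmall : ∀ ρ, 0 < ρ → ρ < δ → ν (ball x ρ) ≤ c * ENNReal.ofReal (ρ ^ (n : ℝ)) := by
    intro ρ h1 h2
    have h3 := hev (y := ρ) (by rw [Real.dist_eq, sub_zero, abs_of_pos h1]; exact h2) h1
    have h4 : ν (closedBall x ρ) ≤ L * volume (closedBall x ρ) :=
      (ENNReal.div_le_iff (measure_closedBall_pos _ _ h1).ne'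
        measure_closedBall_lt_top.ne).1 h3.le
    refine (measure_mono ball_subset_closedBall).trans (h4.trans (le_of_eq ?_))
    rw [Measure.addHaar_closedBall _ _ h1.le, finrank_euclideanSpace_fin, hc, Real.rpow_natCast]
    ring
  have hsplit : Ioi (0 : ℝ) = Ioo 0 δ ∪ Ici δ := by
    ext y
    simp only [mem_Ioi, mem_union, mem_Ioo, mem_Ici]
    constructor
    · intro h
      rcases lt_or_ge y δ with h' | h'
      · exact Or.inl ⟨h, h'⟩
      · exact Or.inr h'
    · rintro (h | h)
      · exact h.1
      · exact hδ.trans_le h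
  unfold radialWolff
  rw [hsplit]
  refine (lintegral_union_le _ _ _).trans_lt (ENNReal.add_lt_top.2 ⟨?_, ?_⟩)
  · have hpow : IntegrableOn (fun ρ : ℝ => ρ ^ (((n : ℝ) - γ) * s - 1)) (Ioo 0 δ) := by
      rw [intervalIntegral.integrableOn_Ioo_rpow_iff hδ]
      have : 0 < ((n : ℝ) - γ) * s := mul_pos (by linarith) hs
      linarith
    have hct' := ENNReal.rpow_ne_top_of_nonneg hs.le hct
    refine lt_of_le_of_lt (b := ∫⁻ ρ in Ioo 0 δ, c ^ s *
      ENNReal.ofReal (ρ ^ (((n : ℝ) - γ) * s - 1))) ?_ ?_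
    · refine setLIntegral_mono' measurableSet_Ioo fun ρ hρ => ?_
      rw [← ofReal_rpow_div_rpow_div hρ.1, ← mul_div_assoc,
        ← ENNReal.mul_rpow_of_nonneg _ _ hs.le, ← mul_div_assoc]
      have := hsmall ρ hρ.1 hρ.2
      gcongr
    · rw [lintegral_const_mul' _ _ hct']
      exact ENNReal.mul_lt_top hct'.lt_top hpow.lintegral_lt_top
  · have hpow : IntegrableOn (fun ρ : ℝ => ρ ^ ((0 - γ) * s - 1)) (Ici δ) := by
      rw [integrableOn_Ici_iff_integrableOn_Ioi]
      refine integrableOn_Ioi_rpow_of_lt ?_ hδ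
      nlinarith [mul_pos hγ0 hs]
    have hct' := ENNReal.rpow_ne_top_of_nonneg hs.le (measure_ne_top ν univ)
    refine lt_of_le_of_lt (b := ∫⁻ ρ in Ici δ, ν univ ^ s *
      ENNReal.ofReal (ρ ^ ((0 - γ) * s - 1))) ?_ ?_
    · refine setLIntegral_mono' measurableSet_Ici fun ρ hρ => ?_
      have hρ0 : 0 < ρ := hδ.trans_le hρ
      rw [← ofReal_rpow_div_rpow_div hρ0, ← mul_div_assoc,
        ← ENNReal.mul_rpow_of_nonneg _ _ hs.le, ← mul_div_assoc, Real.rpow_zero,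
        ENNReal.ofReal_one, mul_one]
      gcongr
      exact measure_mono (subset_univ _)
    · rw [lintegral_const_mul' _ _ hct']
      exact ENNReal.mul_lt_top hct'.lt_top hpow.lintegral_lt_top

lemma ennreal_iSup_rpow {ι : Sort*} {z : ℝ} (hz : 0 < z) (f : ι → ℝ≥0∞) :
    (⨆ i, f i) ^ z = ⨆ i, f i ^ z :=
  (ENNReal.orderIsoRpow z hz).map_iSup f

lemma radialWolff_iSup {s γ : ℝ} (hs : 0 < s) {m : ℕ → ℝ → ℝ≥0∞}
    (hm : ∀ j, Measurable (m j)) (hmono : Monotone m) :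
    radialWolff s γ (fun ρ => ⨆ j, m j ρ) = ⨆ j, radialWolff s γ (m j) := by
  unfold radialWolff
  rw [← lintegral_iSup (fun j => measurable_radialWolff_integrand s γ (hm j))]
  · refine lintegral_congr fun ρ => ?_
    rw [ENNReal.iSup_div, ennreal_iSup_rpow hs, ENNReal.iSup_div]
  · intro i j hij ρ
    have := hmono hij ρ
    simp only
    gcongr

lemma exists_solution_le_intK_add {n : ℕ} {α p q : ℝ} (hp : 1 < p) (hq0 : 0 < q)
    (hqp : q < p - 1) (hγ : 0 < (n : ℝ) - α * p) (hα : 0 < α * p)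
    (σ : Measure (EuclideanSpace ℝ (Fin n))) [IsLocallyFiniteMeasure σ] (hσ : σ ≠ 0)
    (hκ : ∀ x t, embC n α p q σ (ball x t) ≠ ⊤) :
    ∃ (C : ℝ≥0∞) (u : EuclideanSpace ℝ (Fin n) → ℝ≥0∞), C ≠ ⊤ ∧ Measurable u ∧
      (∀ x, u x = wolffPot n α p (σ.withDensity fun y => u y ^ q) x) ∧ (∀ x, 0 < u x) ∧
      ∀ᵐ x ∂(volume : Measure (EuclideanSpace ℝ (Fin n))),
        u x ≤ C * (intK n α p q σ x + wolffPot n α p σ x ^ ((p - 1) / (p - 1 - q))) := by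
  obtain ⟨C, hC, hbound⟩ := exists_wolffPot_le_intK_add (n := n) (α := α) hp hq0 hqp
  have hp1 : 0 < p - 1 := by linarith
  have hs : 0 < 1 / (p - 1) := one_div_pos.2 hp1
  have hθ1 : q * (1 / (p - 1)) < 1 := by
    rw [mul_one_div, div_lt_one hp1]; exact hqp
  obtain ⟨k₀, hk₀⟩ : ∃ k : ℕ, σ (ball (0 : EuclideanSpace ℝ (Fin n)) k) ≠ 0 := by
    by_contra! h
    refine hσ (Measure.measure_univ_eq_zero.1 ?_)
    rw [← iUnion_ball_nat (0 : EuclideanSpace ℝ (Fin n))]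
    exact measure_iUnion_null h
  have hk₀pos : (0 : ℝ) < k₀ := by
    rcases Nat.eq_zero_or_pos k₀ with h | h
    · simp [h] at hk₀
    · exact_mod_cast h
  set B : ℕ → Set (EuclideanSpace ℝ (Fin n)) := fun j => ball 0 ((k₀ + j : ℕ) : ℝ) with hB
  have hBm : ∀ j, MeasurableSet (B j) := fun j => measurableSet_ball
  have hBmono : Monotone B := fun i j hij => ball_subset_ball (by gcongr)
  have hB0 : σ (B 0) ≠ 0 := hk₀
  have hBfin : ∀ j, σ (B j) ≠ ⊤ := fun j => measure_ball_lt_top.ne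
  set d : ℝ≥0∞ := (σ (B 0) / ENNReal.ofReal ((2 * (2 * (k₀ : ℝ))) ^ ((n : ℝ) - α * p))) ^
    (1 / (p - 1)) / 2 with hd
  have hd0 : d ≠ 0 := by
    refine ENNReal.div_ne_zero.2 ⟨(ENNReal.rpow_pos_of_nonneg ?_ hs.le).ne', by norm_num⟩
    exact ENNReal.div_pos hB0 ENNReal.ofReal_ne_top
  have hdt : d ≠ ⊤ := by
    refine ENNReal.div_ne_top (ENNReal.rpow_ne_top_of_nonneg hs.le
      (ENNReal.div_ne_top (hBfin 0) ?_)) (by norm_num)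
    have : 0 < (2 * (2 * (k₀ : ℝ))) ^ ((n : ℝ) - α * p) := by positivity
    simpa using this
  set c : ℝ≥0∞ := d ^ (1 / (1 - q * (1 / (p - 1)))) with hc
  have hc0 : c ≠ 0 := by simp [hc, ENNReal.rpow_eq_zero_iff, hd0, hdt]
  have hct : c ≠ ⊤ := ENNReal.rpow_ne_top_of_ne_zero hd0 hdt
  have hcd : c ^ (q * (1 / (p - 1))) * d = c := by
    have h1 : d = c ^ (1 - q * (1 / (p - 1))) := by
      rw [hc, ← ENNReal.rpow_mul, one_div_mul_cancel (by linarith), ENNReal.rpow_one]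
    conv_lhs => rw [h1]
    rw [← ENNReal.rpow_add _ _ hc0 hct]
    simp
  let μ : ℕ → (EuclideanSpace ℝ (Fin n) → ℝ≥0∞) → Measure (EuclideanSpace ℝ (Fin n)) :=
    fun j v => σ.withDensity ((B j).indicator fun y => v y ^ q)
  let U : ℕ → EuclideanSpace ℝ (Fin n) → ℝ≥0∞ := fun j =>
    Nat.rec ((B 0).indicator fun _ => c) (fun j v => wolffPot n α p (μ j v)) j
  have hU0 : U 0 = (B 0).indicator fun _ => c := rfl
  have hUs : ∀ j, U (j + 1) = wolffPot n α p (μ j (U j)) := fun j => rfl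
  have hUm : ∀ j, Measurable (U j) := by
    intro j
    cases j with
    | zero => exact measurable_const.indicator (hBm 0)
    | succ j => exact measurable_radialWolff_ball _ _ (μ j (U j))
  have hgm : ∀ j, Measurable ((B j).indicator fun y => U j y ^ q) :=
    fun j => ((hUm j).pow_const q).indicator (hBm j)
  have hW0 : ∀ x ∈ B 0, d ≤ wolffPot n α p (σ.restrict (B 0)) x := by
    intro x hx
    have hx' : dist x 0 < k₀ := by simpa [B] using hx
    refine le_trans (le_of_eq ?_) (le_radialWolff hs.le hγ.le
      (monotone_measure_ball (σ.restrict (B 0)) x) (t := 2 * k₀) (by positivity))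
    rw [hd, Measure.restrict_apply' (hBm 0), inter_eq_right.2]
    refine ball_subset_ball' ?_
    rw [dist_comm]
    simp only [Nat.add_zero]
    linarith
  have hμ0 : μ 0 (U 0) = c ^ q • σ.restrict (B 0) := by
    have : ((B 0).indicator fun y => U 0 y ^ q) = (B 0).indicator fun _ => c ^ q := by
      ext y
      by_cases hy : y ∈ B 0 <;> simp [hU0, hy]
    change σ.withDensity ((B 0).indicator fun y => U 0 y ^ q) = _
    rw [this, withDensity_indicator (hBm 0), withDensity_const]
  have hind : ∀ i j, i ≤ j → ∀ v w : EuclideanSpace ℝ (Fin n) → ℝ≥0∞, v ≤ w →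
      ∀ y, (B i).indicator (fun y => v y ^ q) y ≤ (B j).indicator (fun y => w y ^ q) y := by
    intro i j hij v w hvw y
    by_cases hy : y ∈ B i
    · rw [indicator_of_mem hy, indicator_of_mem (hBmono hij hy)]
      exact ENNReal.rpow_le_rpow (hvw y) hq0.le
    · rw [indicator_of_notMem hy]
      exact zero_le
  have hμmono : ∀ j v w, v ≤ w → μ j v ≤ μ (j + 1) w := by
    intro j v w hvw
    exact withDensity_mono (Filter.Eventually.of_forall (hind j _ (Nat.le_succ j) v w hvw))
  have hUstep : ∀ j, U j ≤ U (j + 1) := by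
    intro j
    induction j with
    | zero =>
      intro x
      by_cases hx : x ∈ B 0
      · rw [hU0, indicator_of_mem hx, hUs, hμ0]
        refine le_trans ?_ (le_of_eq (radialWolff_const_mul hs.le
          (ENNReal.rpow_ne_top_of_nonneg hq0.le hct) _).symm)
        rw [← ENNReal.rpow_mul]
        conv_lhs => rw [← hcd]
        gcongr
        exact hW0 x hx
      · rw [hU0, indicator_of_notMem hx]; exact zero_le
    | succ j ih =>
      intro x
      rw [hUs, hUs]
      exact radialWolff_mono hs.le fun ρ _ => hμmono j _ _ ih _
  have hUmono : Monotone U := monotone_nat_of_le_succ hUstep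
  have hfin : ∀ j, IsFiniteMeasure (μ j (U j)) := by
    intro j
    induction j with
    | zero =>
      refine ⟨?_⟩
      rw [hμ0, Measure.smul_apply, Measure.restrict_apply_univ, smul_eq_mul]
      exact ENNReal.mul_lt_top (ENNReal.rpow_ne_top_of_nonneg hq0.le hct).lt_top (hBfin 0).lt_top
    | succ j ih =>
      refine ⟨?_⟩
      change (σ.withDensity ((B (j + 1)).indicator fun y => U (j + 1) y ^ q)) univ < ⊤
      rw [withDensity_apply _ MeasurableSet.univ, Measure.restrict_univ,
        lintegral_indicator (hBm _)]
      refine (lintegral_wolffPot_le_embC hp hq0 (hκ _ _) (μ j (U j))).trans_lt ?_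
      exact ENNReal.mul_lt_top (ENNReal.rpow_ne_top_of_nonneg hq0.le (hκ _ _)).lt_top
        (ENNReal.rpow_ne_top_of_nonneg (by positivity) (measure_ne_top _ _)).lt_top
  have hsub : ∀ j x t, 0 < t →
      μ j (U j) (ball x t) ≤ ∫⁻ y in ball x t, wolffPot n α p (μ j (U j)) y ^ q ∂σ := by
    intro j x t _
    change (σ.withDensity ((B j).indicator fun y => U j y ^ q)) (ball x t) ≤ _
    rw [withDensity_apply _ measurableSet_ball]
    refine lintegral_mono fun y => (indicator_le_self _ _ y).trans ?_
    exact ENNReal.rpow_le_rpow (hUstep j y) hq0.le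
  set u : EuclideanSpace ℝ (Fin n) → ℝ≥0∞ := fun x => ⨆ j, U j x with hu
  have hushift : ∀ x, u x = ⨆ j, U (j + 1) x := fun x =>
    ((hUmono.apply₂ x).iSup_nat_add 1).symm
  have hωu : ∀ x ρ, (σ.withDensity fun y => u y ^ q) (ball x ρ) = ⨆ j, μ j (U j) (ball x ρ) := by
    intro x ρ
    have h1 : ∀ j, μ j (U j) (ball x ρ) =
        ∫⁻ y in ball x ρ, (B j).indicator (fun y => U j y ^ q) y ∂σ :=
      fun j => withDensity_apply _ measurableSet_ball
    simp_rw [h1]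
    rw [withDensity_apply _ measurableSet_ball, ← lintegral_iSup hgm]
    · refine lintegral_congr fun y => le_antisymm ?_ (iSup_le fun j => ?_)
      · rw [hu]
        simp only
        rw [ennreal_iSup_rpow hq0]
        obtain ⟨i, hi⟩ : ∃ i, y ∈ B i := by
          obtain ⟨i, hi⟩ := exists_nat_gt (dist y 0)
          refine ⟨i, ?_⟩
          simp only [hB, mem_ball]
          push_cast
          linarith
        refine iSup_le fun j => le_trans ?_ (le_iSup _ (max i j))
        rw [indicator_of_mem (hBmono (le_max_left i j) hi)]
        exact ENNReal.rpow_le_rpow (hUmono (le_max_right i j) y) hq0.le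
      · exact (indicator_le_self _ _ y).trans
          (ENNReal.rpow_le_rpow (le_iSup (fun j => U j y) j) hq0.le)
    · exact fun i j hij => hind i j hij _ _ (hUmono hij)
  have hμU : μ 0 (U 0) ≠ 0 := by
    rw [hμ0]
    intro h
    have h2 : (c ^ q • σ.restrict (B 0)) univ = 0 := by rw [h]; simp
    rw [Measure.smul_apply, Measure.restrict_apply_univ, smul_eq_mul, mul_eq_zero] at h2
    rcases h2 with h2 | h2
    · exact absurd h2 (by simp [ENNReal.rpow_eq_zero_iff, hc0, hct])
    · exact hB0 h2
  refine ⟨C, u, hC, Measurable.iSup hUm, ?_, ?_, ?_⟩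
  · intro x
    rw [hushift]
    change _ = radialWolff _ _ fun ρ => (σ.withDensity fun y => u y ^ q) (ball x ρ)
    simp_rw [hωu x]
    rw [radialWolff_iSup hs (fun j => (monotone_measure_ball (μ j (U j)) x).measurable)]
    · rfl
    · exact monotone_nat_of_le_succ fun j ρ => hμmono j _ _ (hUstep j) _
  · intro x
    refine lt_of_lt_of_le ?_ (le_iSup (fun j => U j x) 1)
    exact radialWolff_ball_pos hs hγ.le hμU x
  · have hae : ∀ᵐ x ∂(volume : Measure (EuclideanSpace ℝ (Fin n))),
        ∀ j, wolffPot n α p (μ j (U j)) x < ⊤ :=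
      ae_all_iff.2 fun j => ae_radialWolff_ball_lt_top hs hγ (by linarith) (μ j (U j))
    filter_upwards [hae] with x hx
    rw [hushift]
    exact iSup_le fun j => hbound σ (μ j (U j)) (hfin j) hκ (hsub j) x (hx j).ne

lemma lintegral_mul_le_of_factorsThrough {X Z : Type*} [MeasurableSpace X] [MeasurableSpace Z]
    [Countable Z] [MeasurableSingletonClass Z] {μ : Measure X} {ι : X → Z} (hι : Measurable ι)
    {d f g : X → ℝ≥0∞} (hd : d.FactorsThrough ι) (hf : Measurable f) (hg : Measurable g)
    {c : ℝ≥0∞} (h : ∀ z, ∫⁻ x in ι ⁻¹' {z}, f x ∂μ ≤ c * ∫⁻ x in ι ⁻¹' {z}, g x ∂μ) :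
    ∫⁻ x, d x * f x ∂μ ≤ c * ∫⁻ x, d x * g x ∂μ := by
  set e : Z → ℝ≥0∞ := Function.extend ι d 0
  have hed : ∀ x, d x = e (ι x) := fun x => (hd.extend_apply 0 x).symm
  have hem : Measurable e := Measurable.of_discrete
  have key : ∀ f : X → ℝ≥0∞, Measurable f →
      ∫⁻ x, d x * f x ∂μ = ∑' z, e z * ∫⁻ x in ι ⁻¹' {z}, f x ∂μ := by
    intro f hf
    have h1 : ∫⁻ x, d x * f x ∂μ = ∫⁻ z, e z ∂((μ.withDensity f).map ι) := by
      rw [lintegral_map hem hι,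
        lintegral_withDensity_eq_lintegral_mul μ hf (g := fun x => e (ι x)) (hem.comp hι)]
      exact lintegral_congr fun x => by simp [hed, mul_comm]
    rw [h1, lintegral_countable']
    refine tsum_congr fun z => ?_
    rw [Measure.map_apply hι (measurableSet_singleton z),
      withDensity_apply _ (hι (measurableSet_singleton z))]
  rw [key f hf, key g hg, ← ENNReal.tsum_mul_left]
  refine ENNReal.tsum_le_tsum fun z => ?_
  calc _ ≤ e z * (c * ∫⁻ x in ι ⁻¹' {z}, g x ∂μ) := by gcongr; exact h z
    _ = _ := by ring

lemma ennreal_add_rpow_le_mul_add {m : ℝ} (hm : 1 ≤ m) (x y : ℝ≥0∞) :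
    (x + y) ^ m ≤ ENNReal.ofReal m * (x * (x + y) ^ (m - 1)) + y ^ m := by
  have hm0 : 0 < m := by linarith
  by_cases hy : y = ⊤
  · simp [hy, hm0]
  by_cases hx0 : x = 0
  · simp [hx0]
  by_cases hx : x = ⊤
  · have h1 : (⊤ : ℝ≥0∞) ^ (m - 1) ≠ 0 := by
      rw [Ne, ENNReal.rpow_eq_zero_iff]
      simp
      linarith
    have h2 : ENNReal.ofReal m ≠ 0 := by simpa using hm0
    simp [hx, ENNReal.top_mul h1, ENNReal.mul_top h2]
  lift x to ℝ≥0 using hx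
  lift y to ℝ≥0 using hy
  have hx0' : 0 < (x : ℝ) := by
    have : x ≠ 0 := by simpa using hx0
    positivity
  have ht : 0 < (x : ℝ) + y := by positivity
  have key : ((x : ℝ) + y) ^ m ≤ m * (x * ((x : ℝ) + y) ^ (m - 1)) + (y : ℝ) ^ m := by
    have hb := one_add_mul_self_le_rpow_one_add (s := -(x / ((x : ℝ) + y)))
      (by rw [neg_le_neg_iff, div_le_one ht]; linarith [y.coe_nonneg]) hm
    have he : 1 + -((x : ℝ) / (x + y)) = y / (x + y) := by field_simp; ring
    rw [he, Real.div_rpow y.coe_nonneg ht.le, le_div_iff₀ (by positivity)] at hb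
    have h3 : ((x : ℝ) + y) ^ m = (x + y) * (x + y) ^ (m - 1) := by
      rw [Real.rpow_sub_one ht.ne']; field_simp
    have h4 : (1 + m * -((x : ℝ) / (x + y))) * (x + y) ^ m =
        (x + y) ^ m - m * (x * (x + y) ^ (m - 1)) := by
      rw [h3]; field_simp; ring
    linarith
  rw [← ENNReal.coe_add, ← ENNReal.coe_rpow_of_nonneg _ hm0.le,
    ← ENNReal.coe_rpow_of_nonneg _ (by linarith : 0 ≤ m - 1),
    ← ENNReal.coe_rpow_of_nonneg _ hm0.le, ENNReal.ofReal]
  rw [← ENNReal.coe_mul, ← ENNReal.coe_mul, ← ENNReal.coe_add, ENNReal.coe_le_coe,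
    ← NNReal.coe_le_coe]
  push_cast
  rw [Real.coe_toNNReal _ hm0.le]
  exact key

/-- A discrete Muckenhoupt–Wheeden inequality: if each `a j` is constant on the cells of the
coarser partitions and its integrals over cells decay geometrically, the `L^m` norm of the sum
of the `a j` is controlled by that of their maximum. -/
lemma lintegral_sum_rpow_le {X Z : Type*} [MeasurableSpace X] [MeasurableSpace Z]
    [Countable Z] [MeasurableSingletonClass Z] {μ : Measure X} {ι : ℕ → X → Z}
    (hι : ∀ k, Measurable (ι k)) {a : ℕ → X → ℝ≥0∞} (ha : ∀ k, Measurable (a k))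
    (hconst : ∀ k j, k ≤ j → (a j).FactorsThrough (ι k)) {m : ℝ} (hm : 1 < m) (K : ℕ)
    {c : ℕ → ℝ≥0∞} {C : ℝ≥0∞} (hC : ∑' i, c i ≤ C)
    (hc : ∀ l k, l ≤ k → ∀ z,
      ∫⁻ x in ι k ⁻¹' {z}, a l x ∂μ ≤ c (k - l) * ∫⁻ x in ι k ⁻¹' {z}, a k x ∂μ)
    {M : X → ℝ≥0∞} (hM : Measurable M) (haM : ∀ k < K, a k ≤ M)
    (hfin : ∫⁻ x, (∑ j ∈ Finset.range K, a j x) ^ m ∂μ ≠ ⊤) :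
    ∫⁻ x, (∑ j ∈ Finset.range K, a j x) ^ m ∂μ ≤
      (ENNReal.ofReal m * C) ^ m * ∫⁻ x, M x ^ m ∂μ := by
  set S : ℕ → X → ℝ≥0∞ := fun k x => ∑ j ∈ Finset.Ico k K, a j x with hS
  have hSm : ∀ k, Measurable (S k) := fun k => Finset.measurable_fun_sum _ fun j _ => ha j
  have hSK : S K = 0 := by ext x; simp [hS]
  have hS0 : ∀ x, ∑ j ∈ Finset.range K, a j x = S 0 x := fun x => by
    rw [Finset.range_eq_Ico]
  have hSs : ∀ k < K, ∀ x, S k x = a k x + S (k + 1) x := fun k hk x =>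
    Finset.sum_eq_sum_Ico_succ_bot hk _
  have hSanti : ∀ k x, S (k + 1) x ≤ S k x := fun k x =>
    Finset.sum_le_sum_of_subset (f := fun j => a j x)
      (Finset.Ico_subset_Ico_left (Nat.le_succ k))
  have hm1 : 0 < m - 1 := by linarith
  set D : ℕ → X → ℝ≥0∞ := fun k x => S k x ^ (m - 1) - S (k + 1) x ^ (m - 1) with hD
  have hDm : ∀ k, Measurable (D k) := fun k =>
    ((hSm k).pow_const _).sub ((hSm (k + 1)).pow_const _)
  have hDf : ∀ k, (D k).FactorsThrough (ι k) := by
    intro k x y hxy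
    have h1 : S k x = S k y := Finset.sum_congr rfl fun j hj =>
      hconst k j (Finset.mem_Ico.1 hj).1 hxy
    have h2 : S (k + 1) x = S (k + 1) y := Finset.sum_congr rfl fun j hj =>
      hconst k j ((Nat.le_succ k).trans (Finset.mem_Ico.1 hj).1) hxy
    simp only [hD, h1, h2]
  have hDsum : ∀ x, ∀ i ≤ K, S (K - i) x ^ (m - 1) = ∑ k ∈ Finset.Ico (K - i) K, D k x := by
    intro x i
    induction i with
    | zero => intro _; simp [hSK, hm1]
    | succ i ih =>
      intro hi
      have h1 : K - (i + 1) + 1 = K - i := by omega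
      rw [Finset.sum_eq_sum_Ico_succ_bot (by omega), h1, ← ih (by omega)]
      simp only [hD, h1]
      rw [tsub_add_cancel_of_le]
      refine ENNReal.rpow_le_rpow ?_ hm1.le
      rw [← h1]
      exact hSanti _ _
  have hDsum' : ∀ x, ∀ l ≤ K, S l x ^ (m - 1) = ∑ k ∈ Finset.Ico l K, D k x := by
    intro x l hl
    have := hDsum x (K - l) (by omega)
    rwa [Nat.sub_sub_self hl] at this
  have hpt : ∀ x, ∀ i ≤ K, S (K - i) x ^ m ≤
      ENNReal.ofReal m * ∑ l ∈ Finset.Ico (K - i) K, a l x * S l x ^ (m - 1) := by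
    intro x i
    induction i with
    | zero => intro _; simp [hSK]; linarith
    | succ i ih =>
      intro hi
      have h1 : K - (i + 1) + 1 = K - i := by omega
      rw [Finset.sum_eq_sum_Ico_succ_bot (by omega), h1, mul_add]
      refine le_trans ?_ (add_le_add_right (ih (by omega)) _)
      rw [hSs (K - (i + 1)) (by omega), h1]
      exact ennreal_add_rpow_le_mul_add hm.le _ _
  have hpt0 : ∀ x, S 0 x ^ m ≤
      ENNReal.ofReal m * ∑ l ∈ Finset.range K, ∑ k ∈ Finset.Ico l K, D k x * a l x := by
    intro x
    have := hpt x K le_rfl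
    rw [Nat.sub_self, ← Finset.range_eq_Ico] at this
    refine this.trans (le_of_eq ?_)
    congr 1
    refine Finset.sum_congr rfl fun l hl => ?_
    rw [hDsum' x l (Finset.mem_range.1 hl).le, Finset.mul_sum]
    exact Finset.sum_congr rfl fun k _ => mul_comm _ _
  simp_rw [hS0] at hfin ⊢
  set I : ℝ≥0∞ := ∫⁻ x, S 0 x ^ m ∂μ with hI
  set J : ℝ≥0∞ := ∫⁻ x, M x ^ m ∂μ with hJ
  have hstep : I ≤ ENNReal.ofReal m * C * ∫⁻ x, M x * S 0 x ^ (m - 1) ∂μ := by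
    have hDa : ∀ k l, Measurable fun x => D k x * a l x := fun k l => (hDm k).mul (ha l)
    calc I ≤ ∫⁻ x, ENNReal.ofReal m *
          ∑ l ∈ Finset.range K, ∑ k ∈ Finset.Ico l K, D k x * a l x ∂μ := lintegral_mono hpt0
      _ = ENNReal.ofReal m *
          ∑ l ∈ Finset.range K, ∑ k ∈ Finset.Ico l K, ∫⁻ x, D k x * a l x ∂μ := by
        rw [lintegral_const_mul _ (Finset.measurable_fun_sum _ fun l _ =>
          Finset.measurable_fun_sum _ fun k _ => hDa k l),
          lintegral_finsetSum _ fun l _ => Finset.measurable_fun_sum _ fun k _ => hDa k l]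
        congr 1
        exact Finset.sum_congr rfl fun l _ => lintegral_finsetSum _ fun k _ => hDa k l
      _ ≤ ENNReal.ofReal m *
          ∑ l ∈ Finset.range K, ∑ k ∈ Finset.Ico l K, c (k - l) * ∫⁻ x, D k x * a k x ∂μ := by
        gcongr with l hl k hk
        exact lintegral_mul_le_of_factorsThrough (hι k) (hDf k) (ha l) (ha k)
          (hc l k (Finset.mem_Ico.1 hk).1)
      _ = ENNReal.ofReal m *
          ∑ k ∈ Finset.range K, ∑ l ∈ Finset.range (k + 1),
            c (k - l) * ∫⁻ x, D k x * a k x ∂μ := by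
        congr 1
        refine Finset.sum_comm' fun l k => ?_
        simp only [Finset.mem_range, Finset.mem_Ico]
        omega
      _ ≤ ENNReal.ofReal m * ∑ k ∈ Finset.range K, C * ∫⁻ x, D k x * M x ∂μ := by
        gcongr with k hk
        rw [← Finset.sum_mul]
        gcongr with x
        · have hr := Finset.sum_range_reflect c (k + 1)
          simp only [Nat.add_sub_cancel] at hr
          rw [hr]
          exact (ENNReal.sum_le_tsum _).trans hC
        · exact haM k (Finset.mem_range.1 hk) x
      _ = _ := by
        rw [← Finset.mul_sum, ← lintegral_finsetSum (f := fun k x => D k x * M x) _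
          fun k _ => (hDm k).mul hM, mul_assoc]
        congr 2
        refine lintegral_congr fun x => ?_
        rw [← Finset.sum_mul, hDsum' x 0 (Nat.zero_le _), Finset.range_eq_Ico, mul_comm]
  have hconj : m.HolderConjugate (m / (m - 1)) := Real.HolderConjugate.conjExponent hm
  have hhol : ∫⁻ x, M x * S 0 x ^ (m - 1) ∂μ ≤ J ^ (1 / m) * I ^ (1 - 1 / m) := by
    refine (ENNReal.lintegral_mul_le_Lp_mul_Lq μ hconj hM.aemeasurable
      ((hSm 0).pow_const (m - 1)).aemeasurable).trans (le_of_eq ?_)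
    have h1 : 1 / (m / (m - 1)) = 1 - 1 / m := by field_simp
    rw [h1]
    congr 2
    refine lintegral_congr fun x => ?_
    rw [← ENNReal.rpow_mul]
    congr 1
    field_simp
  by_cases hI0 : I = 0
  · simp [hI0]
  have hm0 : 0 < m := by linarith
  have hI1 : I ^ (1 / m) ≤ ENNReal.ofReal m * C * J ^ (1 / m) := by
    have h1 : I ^ (1 / m) * I ^ (1 - 1 / m) ≤
        ENNReal.ofReal m * C * J ^ (1 / m) * I ^ (1 - 1 / m) := by
      rw [← ENNReal.rpow_add _ _ hI0 hfin, add_sub_cancel, ENNReal.rpow_one, mul_assoc]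
      exact hstep.trans (by gcongr)
    refine (ENNReal.mul_le_mul_iff_left ?_ ?_).1 h1
    · simp [ENNReal.rpow_eq_zero_iff, hI0, hfin]
    · exact ENNReal.rpow_ne_top_of_ne_zero hI0 hfin
  have := ENNReal.rpow_le_rpow hI1 hm0.le
  rwa [← ENNReal.rpow_mul, ENNReal.mul_rpow_of_nonneg _ _ hm0.le, ← ENNReal.rpow_mul,
    one_div_mul_cancel hm0.ne', ENNReal.rpow_one, ENNReal.rpow_one] at this

/-- The index of the half-open cube of side `h`, with vertices in `hℤⁿ`, containing `x`. -/
noncomputable def cellIndex {n : ℕ} (h : ℝ) (x : EuclideanSpace ℝ (Fin n)) : Fin n → ℤ :=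
  fun i => ⌊x i / h⌋

/-- The union of the cube of side `h` with index `z` and its neighbours. -/
def tripleCell {n : ℕ} (h : ℝ) (z : Fin n → ℤ) : Set (EuclideanSpace ℝ (Fin n)) :=
  {y | ∀ i, |cellIndex h y i - z i| ≤ 1}

lemma measurable_cellIndex {n : ℕ} (h : ℝ) :
    Measurable (cellIndex h : EuclideanSpace ℝ (Fin n) → Fin n → ℤ) := by
  refine measurable_pi_lambda _ fun i => Int.measurable_floor.comp ?_
  have : Measurable fun x : EuclideanSpace ℝ (Fin n) => x i := by fun_prop
  exact this.div_const h

lemma measurableSet_tripleCell {n : ℕ} (h : ℝ) (z : Fin n → ℤ) :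
    MeasurableSet (tripleCell h z) := by
  have : tripleCell h z = cellIndex h ⁻¹' {w | ∀ i, |w i - z i| ≤ 1} := rfl
  rw [this]
  exact measurable_cellIndex h (MeasurableSet.of_discrete)

lemma mem_tripleCell_comm {n : ℕ} {h : ℝ} {x y : EuclideanSpace ℝ (Fin n)} :
    x ∈ tripleCell h (cellIndex h y) ↔ y ∈ tripleCell h (cellIndex h x) :=
  forall_congr' fun i => by rw [abs_sub_comm]

lemma volume_setOf_forall_mem_Ico {n : ℕ} (a b : Fin n → ℝ) :
    volume {x : EuclideanSpace ℝ (Fin n) | ∀ i, x i ∈ Ico (a i) (b i)} =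
      ∏ i, ENNReal.ofReal (b i - a i) := by
  rw [← Real.volume_pi_Ico, ← (EuclideanSpace.volume_preserving_symm_measurableEquiv_toLp
    (Fin n)).measure_preimage (MeasurableSet.univ_pi fun i => measurableSet_Ico).nullMeasurableSet]
  congr 1
  ext x
  simp [Set.mem_pi]

lemma volume_preimage_cellIndex {n : ℕ} {h : ℝ} (hh : 0 < h) (z : Fin n → ℤ) :
    volume (cellIndex h ⁻¹' {z} : Set (EuclideanSpace ℝ (Fin n))) = ENNReal.ofReal h ^ n := by
  have : (cellIndex h ⁻¹' {z} : Set (EuclideanSpace ℝ (Fin n))) =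
      {x | ∀ i, x i ∈ Ico (z i * h) (z i * h + h)} := by
    ext x
    simp only [mem_preimage, mem_singleton_iff, mem_ofPred_eq, cellIndex, funext_iff,
      Int.floor_eq_iff, mem_Ico, le_div_iff₀ hh, div_lt_iff₀ hh, add_mul, one_mul]
  rw [this, volume_setOf_forall_mem_Ico]
  simp

lemma volume_tripleCell {n : ℕ} {h : ℝ} (hh : 0 < h) (z : Fin n → ℤ) :
    volume (tripleCell h z : Set (EuclideanSpace ℝ (Fin n))) = ENNReal.ofReal (3 * h) ^ n := by
  have : (tripleCell h z : Set (EuclideanSpace ℝ (Fin n))) =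
      {x | ∀ i, x i ∈ Ico ((z i - 1) * h) ((z i - 1) * h + 3 * h)} := by
    ext x
    refine forall_congr' fun i => ?_
    have h1 : |cellIndex h x i - z i| ≤ 1 ↔ z i - 1 ≤ ⌊x i / h⌋ ∧ ⌊x i / h⌋ < z i + 2 := by
      rw [abs_le, cellIndex]
      omega
    rw [h1, Int.le_floor, Int.floor_lt, mem_Ico, le_div_iff₀ hh, div_lt_iff₀ hh]
    push_cast
    rw [show ((z i : ℝ) - 1) * h + 3 * h = (z i + 2) * h by ring]
  rw [this, volume_setOf_forall_mem_Ico]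
  simp

lemma ball_subset_tripleCell {n : ℕ} {h : ℝ} (hh : 0 < h) (x : EuclideanSpace ℝ (Fin n)) :
    ball x h ⊆ tripleCell h (cellIndex h x) := by
  intro y hy i
  have h1 : |y i - x i| < h := by
    refine lt_of_le_of_lt ?_ hy
    rw [dist_eq_norm]
    exact PiLp.norm_apply_le (y - x) i
  rw [abs_lt] at h1
  have h2 : y i / h < x i / h + 1 := by
    rw [← div_self hh.ne', ← add_div]; gcongr; linarith
  have h3 : x i / h < y i / h + 1 := by
    rw [← div_self hh.ne', ← add_div]; gcongr; linarith
  have h4 : ⌊y i / h⌋ < ⌊x i / h⌋ + 2 := by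
    rw [Int.floor_lt]; push_cast; linarith [Int.lt_floor_add_one (x i / h)]
  have h5 : ⌊x i / h⌋ < ⌊y i / h⌋ + 2 := by
    rw [Int.floor_lt]; push_cast; linarith [Int.lt_floor_add_one (y i / h)]
  rw [abs_le, cellIndex, cellIndex]
  omega

lemma tripleCell_subset_ball {n : ℕ} {h : ℝ} (hh : 0 < h) (x : EuclideanSpace ℝ (Fin n)) :
    tripleCell h (cellIndex h x) ⊆ ball x ((2 * n + 1) * h) := by
  intro y hy
  have h1 : ∀ i, |y i - x i| ≤ 2 * h := by
    intro i
    have h2 := hy i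
    rw [abs_le, cellIndex, cellIndex] at h2
    have h3 : (⌊y i / h⌋ : ℝ) ≤ ⌊x i / h⌋ + 1 := by exact_mod_cast (by omega)
    have h4 : (⌊x i / h⌋ : ℝ) ≤ ⌊y i / h⌋ + 1 := by exact_mod_cast (by omega)
    have h5 : y i / h ≤ x i / h + 2 := by
      linarith [Int.lt_floor_add_one (y i / h), Int.floor_le (x i / h)]
    have h6 : x i / h ≤ y i / h + 2 := by
      linarith [Int.lt_floor_add_one (x i / h), Int.floor_le (y i / h)]
    rw [div_add' _ _ _ hh.ne', div_le_div_iff_of_pos_right hh] at h5 h6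
    rw [abs_le]
    constructor <;> linarith
  rw [mem_ball, EuclideanSpace.dist_eq]
  refine lt_of_le_of_lt (Real.sqrt_le_sqrt (Finset.sum_le_sum (g := fun _ => (2 * h) ^ 2)
    fun i _ => ?_)) ?_
  · rw [Real.dist_eq, sq_abs, sq_le_sq, abs_of_pos (by positivity : 0 < 2 * h)]
    exact h1 i
  · rw [Finset.sum_const, Finset.card_univ, Fintype.card_fin, nsmul_eq_mul,
      Real.sqrt_lt' (by positivity)]
    have : (0 : ℝ) ≤ n := n.cast_nonneg
    rcases Nat.eq_zero_or_pos n with h0 | h0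
    · simp [h0]; positivity
    · have h1 : (1 : ℝ) ≤ n := by exact_mod_cast h0
      nlinarith [sq_nonneg h, mul_pos hh hh, mul_nonneg (mul_pos hh hh).le this]

lemma cellIndex_mul {n : ℕ} (h : ℝ) (j : ℕ) (x : EuclideanSpace ℝ (Fin n)) :
    cellIndex (2 ^ j * h) x = fun i => cellIndex h x i / 2 ^ j := by
  ext i
  have := Int.floor_div_natCast (x i / h) (2 ^ j)
  push_cast at this
  rw [cellIndex, mul_comm, ← div_div, this, cellIndex]

lemma tripleCell_subset_tripleCell_mul {n : ℕ} (h : ℝ) (j : ℕ) (x : EuclideanSpace ℝ (Fin n)) :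
    tripleCell h (cellIndex h x) ⊆ tripleCell (2 ^ j * h) (cellIndex (2 ^ j * h) x) := by
  have key : ∀ a b : ℤ, a ≤ b + 1 → a / 2 ^ j ≤ b / 2 ^ j + 1 := by
    intro a b hab
    have h2 : (0 : ℤ) < 2 ^ j := by positivity
    rw [← Int.add_mul_ediv_right _ _ h2.ne']
    exact Int.ediv_le_ediv h2 (by linarith)
  intro y hy i
  have h1 := abs_le.1 (hy i)
  rw [cellIndex_mul, cellIndex_mul, abs_le]
  have h2 := key (cellIndex h y i) (cellIndex h x i) (by omega)
  have h3 := key (cellIndex h x i) (cellIndex h y i) (by omega)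
  simp only
  constructor <;> linarith

lemma setLIntegral_measure_tripleCell_le {n : ℕ} {h : ℝ} (hh : 0 < h) (j : ℕ)
    (ν : Measure (EuclideanSpace ℝ (Fin n))) [SFinite ν] (z : Fin n → ℤ) :
    ∫⁻ x in cellIndex (2 ^ j * h) ⁻¹' {z}, ν (tripleCell h (cellIndex h x)) ≤
      ENNReal.ofReal (3 * h) ^ n * ν (tripleCell (2 ^ j * h) z) := by
  set Q : Set (EuclideanSpace ℝ (Fin n)) := cellIndex (2 ^ j * h) ⁻¹' {z} with hQ
  have hQm : MeasurableSet Q := measurable_cellIndex _ (measurableSet_singleton z)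
  let G : Set (EuclideanSpace ℝ (Fin n) × EuclideanSpace ℝ (Fin n)) :=
    {w | w.2 ∈ tripleCell h (cellIndex h w.1)}
  have hG : MeasurableSet G := by
    have : G = (fun w : EuclideanSpace ℝ (Fin n) × EuclideanSpace ℝ (Fin n) =>
        (cellIndex h w.1, cellIndex h w.2)) ⁻¹' {w | ∀ i, |w.2 i - w.1 i| ≤ 1} := rfl
    rw [this]
    exact (((measurable_cellIndex h).comp measurable_fst).prodMk
      ((measurable_cellIndex h).comp measurable_snd)) MeasurableSet.of_discrete
  calc ∫⁻ x in Q, ν (tripleCell h (cellIndex h x))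
      = ∫⁻ x in Q, ∫⁻ y, G.indicator 1 (x, y) ∂ν := by
        refine lintegral_congr fun x => ?_
        rw [← lintegral_indicator_one (measurableSet_tripleCell h _)]
        rfl
    _ = ∫⁻ y, (∫⁻ x in Q, G.indicator 1 (x, y)) ∂ν :=
        lintegral_lintegral_swap (measurable_one.indicator hG).aemeasurable
    _ ≤ ∫⁻ y, (tripleCell (2 ^ j * h) z).indicator
          (fun _ => ENNReal.ofReal (3 * h) ^ n) y ∂ν := by
        refine lintegral_mono fun y => ?_
        by_cases hy : y ∈ tripleCell (2 ^ j * h) z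
        · rw [indicator_of_mem hy, ← volume_tripleCell hh (cellIndex h y),
            ← lintegral_indicator_one (measurableSet_tripleCell h _)]
          refine (setLIntegral_le_lintegral _ _).trans (lintegral_mono fun x => ?_)
          by_cases hxy : (x, y) ∈ G
          · rw [indicator_of_mem hxy, indicator_of_mem (mem_tripleCell_comm.1 hxy)]
            rfl
          · rw [indicator_of_notMem hxy]
            exact zero_le
        · rw [indicator_of_notMem hy]
          refine (setLIntegral_eq_zero hQm fun x hx => ?_).le
          refine indicator_of_notMem (fun hxy => hy ?_) _
          have := tripleCell_subset_tripleCell_mul h j x hxy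
          rwa [show cellIndex (2 ^ j * h) x = z from hx] at this
    _ = _ := lintegral_indicator_const (measurableSet_tripleCell _ z) _

lemma cellDecay_identity {n : ℕ} {h γ s : ℝ} (hh : 0 < h) (j : ℕ) (B : ℝ≥0∞) (hs : 0 < s) :
    (ENNReal.ofReal (3 * h) ^ n * B / ENNReal.ofReal (h ^ γ)) ^ s *
        (ENNReal.ofReal (2 ^ j * h) ^ n) ^ (1 - s) =
      ENNReal.ofReal (3 ^ (n * s)) * ENNReal.ofReal (2 ^ (-((n - γ) * s))) ^ j *
        ((B / ENNReal.ofReal ((2 ^ j * h) ^ γ)) ^ s * ENNReal.ofReal (2 ^ j * h) ^ n) := by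
  have hH : 0 < 2 ^ j * h := by positivity
  rw [mul_comm _ B, mul_div_assoc, ENNReal.mul_rpow_of_nonneg _ _ hs.le, div_eq_mul_inv B,
    ENNReal.mul_rpow_of_nonneg _ _ hs.le]
  rw [← ENNReal.ofReal_inv_of_pos (by positivity), ENNReal.ofReal_rpow_of_pos (by positivity),
    ← ENNReal.ofReal_pow (by positivity), ← ENNReal.ofReal_pow (by positivity),
    ← ENNReal.ofReal_pow (by positivity), ENNReal.ofReal_rpow_of_pos (by positivity),
    ← ENNReal.ofReal_div_of_pos (by positivity), ENNReal.ofReal_rpow_of_pos (by positivity)]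
  have key : ((3 * h) ^ n / h ^ γ) ^ s * ((2 ^ j * h) ^ n) ^ (1 - s) =
      3 ^ (n * s) * (2 ^ (-((n - γ) * s))) ^ j *
        ((((2 ^ j * h) ^ γ)⁻¹) ^ s * (2 ^ j * h) ^ n) := by
    have hl : ∀ x y : ℝ, 0 < x → 0 < y → Real.log x = Real.log y → x = y :=
      fun x y hx hy hxy => Real.log_injOn_pos hx hy hxy
    refine hl _ _ (by positivity) (by positivity) ?_
    rw [Real.log_mul (by positivity) (by positivity), Real.log_mul (by positivity) (by positivity),
      Real.log_mul (by positivity) (by positivity), Real.log_mul (by positivity) (by positivity),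
      Real.log_rpow (by positivity), Real.log_rpow (by positivity), Real.log_rpow (by positivity),
      Real.log_rpow (by positivity),
      Real.log_pow, Real.log_pow, Real.log_div (by positivity) (by positivity),
      Real.log_pow, Real.log_rpow (by positivity), Real.log_rpow (by positivity),
      Real.log_inv, Real.log_rpow (by positivity), Real.log_mul (by positivity) (by positivity),
      Real.log_mul (by positivity) (by positivity), Real.log_pow]
    ring
  calc _ = B ^ s * ENNReal.ofReal (((3 * h) ^ n / h ^ γ) ^ s * ((2 ^ j * h) ^ n) ^ (1 - s)) := by
        rw [ENNReal.ofReal_mul (by positivity)]; ring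
    _ = _ := by
        rw [key, ENNReal.ofReal_mul (by positivity), ENNReal.ofReal_mul (by positivity),
          ENNReal.ofReal_mul (by positivity)]
        ring

/-- The density `ν(T) / h^γ` of `ν` on the tripled cube `T` of side `h` around `x`. -/
noncomputable def cellDensity {n : ℕ} (γ : ℝ) (ν : Measure (EuclideanSpace ℝ (Fin n))) (h : ℝ)
    (x : EuclideanSpace ℝ (Fin n)) : ℝ≥0∞ :=
  ν (tripleCell h (cellIndex h x)) / ENNReal.ofReal (h ^ γ)

lemma measurable_cellDensity {n : ℕ} (γ : ℝ) (ν : Measure (EuclideanSpace ℝ (Fin n))) (h : ℝ) :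
    Measurable (cellDensity γ ν h) := by
  have : Measurable fun z : Fin n → ℤ => ν (tripleCell h z) := Measurable.of_discrete
  exact (this.comp (measurable_cellIndex h)).div_const _

lemma setLIntegral_cellDensity_rpow_le {n : ℕ} {h γ s : ℝ} (hh : 0 < h) (hs : 0 < s)
    (hs1 : s ≤ 1) (j : ℕ) (ν : Measure (EuclideanSpace ℝ (Fin n))) [SFinite ν] (z : Fin n → ℤ) :
    ∫⁻ x in cellIndex (2 ^ j * h) ⁻¹' {z}, cellDensity γ ν h x ^ s ≤
      ENNReal.ofReal (3 ^ (n * s)) * ENNReal.ofReal (2 ^ (-((n - γ) * s))) ^ j *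
        ∫⁻ x in cellIndex (2 ^ j * h) ⁻¹' {z}, cellDensity γ ν (2 ^ j * h) x ^ s := by
  set Q : Set (EuclideanSpace ℝ (Fin n)) := cellIndex (2 ^ j * h) ⁻¹' {z} with hQ
  have hQm : MeasurableSet Q := measurable_cellIndex _ (measurableSet_singleton z)
  have hH : 0 < 2 ^ j * h := by positivity
  have hQv : volume Q = ENNReal.ofReal (2 ^ j * h) ^ n := volume_preimage_cellIndex hH z
  have hR : ∫⁻ x in Q, cellDensity γ ν (2 ^ j * h) x ^ s =
      (ν (tripleCell (2 ^ j * h) z) / ENNReal.ofReal ((2 ^ j * h) ^ γ)) ^ s *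
        ENNReal.ofReal (2 ^ j * h) ^ n := by
    rw [← hQv, ← setLIntegral_const]
    refine setLIntegral_congr_fun hQm fun x hx => ?_
    simp only [cellDensity]
    rw [show cellIndex (2 ^ j * h) x = z from hx]
  rw [hR, ← cellDecay_identity hh j _ hs, ← hQv]
  calc ∫⁻ x in Q, cellDensity γ ν h x ^ s
      = ∫⁻ x in Q, cellDensity γ ν h x ^ s * (1 : ℝ≥0∞) ^ (1 - s) := by simp
    _ ≤ (∫⁻ x in Q, cellDensity γ ν h x) ^ s * (∫⁻ _ in Q, (1 : ℝ≥0∞)) ^ (1 - s) :=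
        ENNReal.lintegral_mul_norm_pow_le (measurable_cellDensity γ ν h).aemeasurable
          aemeasurable_const hs.le (by linarith) (by ring)
    _ ≤ _ := by
        rw [setLIntegral_one]
        gcongr
        simp only [cellDensity, div_eq_mul_inv]
        rw [lintegral_mul_const' _ _ (by
          have : 0 < h ^ γ := by positivity
          simpa using this)]
        gcongr
        exact setLIntegral_measure_tripleCell_le hh j ν z

lemma lintegral_sum_cellDensity_rpow_ne_top {n : ℕ} {h γ s m : ℝ} (hh : 0 < h) (hs : 0 < s)
    (hm : 0 < m) (ν : Measure (EuclideanSpace ℝ (Fin n))) [IsFiniteMeasure ν] {R : ℝ}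
    (hν : ν (ball 0 R)ᶜ = 0) (K : ℕ) :
    ∫⁻ x, (∑ k ∈ Finset.range K, cellDensity γ ν (2 ^ k * h) x ^ s) ^ m ≠ ⊤ := by
  set c : ℝ≥0∞ := ∑ k ∈ Finset.range K, (ν univ / ENNReal.ofReal ((2 ^ k * h) ^ γ)) ^ s with hc
  have hct : c ≠ ⊤ := by
    refine ENNReal.sum_ne_top.2 fun k _ => ENNReal.rpow_ne_top_of_nonneg hs.le
      (ENNReal.div_ne_top (measure_ne_top _ _) ?_)
    have : 0 < (2 ^ k * h) ^ γ := by positivity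
    simpa using this
  set T : ℝ := R + (2 * n + 1) * (2 ^ K * h) with hT
  have hzero : ∀ x ∉ ball (0 : EuclideanSpace ℝ (Fin n)) T, ∀ k < K,
      cellDensity γ ν (2 ^ k * h) x = 0 := by
    intro x hx k hk
    have h0 : ν (tripleCell (2 ^ k * h) (cellIndex (2 ^ k * h) x)) = 0 := by
      refine measure_mono_null (t := (ball 0 R)ᶜ) (fun y hy hyR => hx ?_) hν
      have h1 : dist y x < (2 * n + 1) * (2 ^ k * h) :=
        tripleCell_subset_ball (by positivity) x hy
      have h2 : (2 * (n : ℝ) + 1) * (2 ^ k * h) ≤ (2 * n + 1) * (2 ^ K * h) := by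
        gcongr
        norm_num
      rw [mem_ball] at hyR ⊢
      have h3 := dist_triangle_left x 0 y
      linarith
    rw [cellDensity, h0, ENNReal.zero_div]
  have hle : ∀ x, (∑ k ∈ Finset.range K, cellDensity γ ν (2 ^ k * h) x ^ s) ^ m ≤
      (ball (0 : EuclideanSpace ℝ (Fin n)) T).indicator (fun _ => c ^ m) x := by
    intro x
    by_cases hx : x ∈ ball (0 : EuclideanSpace ℝ (Fin n)) T
    · rw [indicator_of_mem hx]
      refine ENNReal.rpow_le_rpow (Finset.sum_le_sum fun k _ => ?_) hm.le
      rw [cellDensity]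
      gcongr
      exact subset_univ _
    · rw [Finset.sum_eq_zero fun k hk => by
        rw [hzero x hx k (Finset.mem_range.1 hk), ENNReal.zero_rpow_of_pos hs],
        ENNReal.zero_rpow_of_pos hm]
      exact zero_le
  refine ((lintegral_mono hle).trans_lt ?_).ne
  rw [lintegral_indicator_const measurableSet_ball]
  exact ENNReal.mul_lt_top (ENNReal.rpow_ne_top_of_nonneg hm.le hct).lt_top measure_ball_lt_top

lemma lintegral_sum_cellDensity_rpow_le {n : ℕ} {h γ s m : ℝ} (hh : 0 < h) (hs : 0 < s)
    (hs1 : s ≤ 1) (hm : 1 < m) (ν : Measure (EuclideanSpace ℝ (Fin n))) [IsFiniteMeasure ν]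
    {R : ℝ} (hν : ν (ball 0 R)ᶜ = 0) (K : ℕ) {M : EuclideanSpace ℝ (Fin n) → ℝ≥0∞}
    (hM : ∀ k < K, ∀ x, cellDensity γ ν (2 ^ k * h) x ^ (s * m) ≤ M x) :
    ∫⁻ x, (∑ k ∈ Finset.range K, cellDensity γ ν (2 ^ k * h) x ^ s) ^ m ≤
      (ENNReal.ofReal m * (ENNReal.ofReal (3 ^ (n * s)) *
        (1 - ENNReal.ofReal (2 ^ (-((n - γ) * s))))⁻¹)) ^ m * ∫⁻ x, M x := by
  have hm0 : 0 < m := by linarith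
  refine (lintegral_sum_rpow_le (ι := fun k => cellIndex (2 ^ k * h))
    (a := fun k x => cellDensity γ ν (2 ^ k * h) x ^ s)
    (c := fun j => ENNReal.ofReal (3 ^ (n * s)) * ENNReal.ofReal (2 ^ (-((n - γ) * s))) ^ j)
    (C := ENNReal.ofReal (3 ^ (n * s)) * (1 - ENNReal.ofReal (2 ^ (-((n - γ) * s))))⁻¹)
    (M := fun x => ⨆ k ∈ Finset.range K, cellDensity γ ν (2 ^ k * h) x ^ s)
    (fun k => measurable_cellIndex _) (fun k => (measurable_cellDensity γ ν _).pow_const s)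
    ?_ hm K ?_ ?_ ?_ ?_ ?_).trans ?_
  · intro k j hkj x y hxy
    have h1 : (2 : ℝ) ^ j * h = 2 ^ (j - k) * (2 ^ k * h) := by
      rw [← mul_assoc, ← pow_add, Nat.sub_add_cancel hkj]
    have h2 : cellIndex (2 ^ j * h) x = cellIndex (2 ^ j * h) y := by
      rw [h1, cellIndex_mul _ (j - k), cellIndex_mul _ (j - k),
        show cellIndex (2 ^ k * h) x = cellIndex (2 ^ k * h) y from hxy]
    simp only [cellDensity, h2]
  · rw [ENNReal.tsum_mul_left, ENNReal.tsum_geometric]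
  · intro l k hlk z
    have h1 : (2 : ℝ) ^ k * h = 2 ^ (k - l) * (2 ^ l * h) := by
      rw [← mul_assoc, ← pow_add, Nat.sub_add_cancel hlk]
    rw [h1]
    exact setLIntegral_cellDensity_rpow_le (by positivity) hs hs1 (k - l) ν z
  · exact Measurable.biSup _ (Finset.countable_toSet _) fun k _ =>
      (measurable_cellDensity γ ν _).pow_const s
  · intro k hk x
    exact le_biSup (fun k => cellDensity γ ν (2 ^ k * h) x ^ s) (Finset.mem_range.2 hk)
  · exact lintegral_sum_cellDensity_rpow_ne_top hh hs hm0 ν hν K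
  · gcongr with x
    rw [ennreal_iSup_rpow hm0]
    refine iSup_le fun k => ?_
    rw [ennreal_iSup_rpow hm0]
    refine iSup_le fun hk => ?_
    rw [← ENNReal.rpow_mul]
    exact hM k (Finset.mem_range.1 hk) x

lemma setLIntegral_Ioc_le_sum (F : ℝ → ℝ≥0∞) {h : ℝ} (hh : 0 < h) (K : ℕ) :
    ∫⁻ ρ in Ioc h (2 ^ K * h), F ρ ≤
      ∑ k ∈ Finset.range K, ∫⁻ ρ in Ioc (2 ^ k * h) (2 ^ (k + 1) * h), F ρ := by
  induction K with
  | zero => simp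
  | succ K ih =>
    have h1 : h ≤ 2 ^ K * h := le_mul_of_one_le_left hh.le (one_le_pow₀ (by norm_num))
    have h2 : (2 : ℝ) ^ K * h ≤ 2 ^ (K + 1) * h := by gcongr <;> norm_num
    rw [← Ioc_union_Ioc_eq_Ioc h1 h2, Finset.sum_range_succ]
    exact (lintegral_union_le _ _ _).trans (by gcongr)

lemma setLIntegral_Ioc_wolff_le {n : ℕ} {h γ s : ℝ} (hh : 0 < h) (hs : 0 < s) (hγ : 0 ≤ γ)
    (ν : Measure (EuclideanSpace ℝ (Fin n))) (x : EuclideanSpace ℝ (Fin n)) :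
    ∫⁻ ρ in Ioc h (2 * h),
      (ν (ball x ρ) / ENNReal.ofReal (ρ ^ γ)) ^ s / ENNReal.ofReal ρ ≤
      ENNReal.ofReal (2 ^ γ) ^ s * cellDensity γ ν (2 * h) x ^ s := by
  have hH : 0 < 2 * h := by positivity
  calc _ ≤ ∫⁻ ρ in Ioc h (2 * h),
        (ENNReal.ofReal (2 ^ γ) * cellDensity γ ν (2 * h) x) ^ s / ENNReal.ofReal h := by
        refine setLIntegral_mono' measurableSet_Ioc fun ρ hρ => ?_
        have h1 : ν (ball x ρ) ≤ ν (tripleCell (2 * h) (cellIndex (2 * h) x)) :=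
          measure_mono ((ball_subset_ball hρ.2).trans (ball_subset_tripleCell hH x))
        have h2 : h ^ γ ≤ ρ ^ γ := Real.rpow_le_rpow hh.le hρ.1.le hγ
        have h3 : ENNReal.ofReal (2 ^ γ) * cellDensity γ ν (2 * h) x =
            ν (tripleCell (2 * h) (cellIndex (2 * h) x)) / ENNReal.ofReal (h ^ γ) := by
          rw [cellDensity, Real.mul_rpow (by norm_num) hh.le, ENNReal.ofReal_mul (by positivity),
            mul_comm, mul_comm (ENNReal.ofReal (2 ^ γ)), ENNReal.mul_div_right_comm.symm,
            ENNReal.mul_div_mul_right _ _ (by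
              have : (0 : ℝ) < 2 ^ γ := by positivity
              simpa using this) ENNReal.ofReal_ne_top]
        rw [h3]
        gcongr
        exact hρ.1.le
    _ = _ := by
        rw [setLIntegral_const, Real.volume_Ioc, ENNReal.mul_rpow_of_nonneg _ _ hs.le,
          show 2 * h - h = h by ring, ENNReal.div_mul_cancel (by simpa using hh)
          ENNReal.ofReal_ne_top]

lemma ennreal_sum_rpow_le {ι : Type*} (T : Finset ι) (f : ι → ℝ≥0∞) {t : ℝ} (ht : 1 ≤ t) :
    ∑ i ∈ T, f i ^ t ≤ (∑ i ∈ T, f i) ^ t := by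
  classical
  induction T using Finset.induction_on with
  | empty => simp
  | insert i T hi ih =>
    rw [Finset.sum_insert hi, Finset.sum_insert hi]
    exact (add_le_add_right ih _).trans (ENNReal.add_rpow_le_rpow_add _ _ ht)

lemma cellDensity_restrict_rpow_le {n : ℕ} {h γ s : ℝ} (hh : 0 < h) (hs : 0 < s)
    {σ : Measure (EuclideanSpace ℝ (Fin n))} {x : EuclideanSpace ℝ (Fin n)} {g : ℝ≥0∞}
    (hg : ∀ t, 0 < t → (σ (ball x t) / ENNReal.ofReal (t ^ γ)) ^ s ≤ g)
    (B : Set (EuclideanSpace ℝ (Fin n))) :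
    cellDensity γ (σ.restrict B) h x ^ s ≤ ENNReal.ofReal ((2 * n + 1) ^ γ) ^ s * g := by
  have hA : (0 : ℝ) < 2 * n + 1 := by positivity
  have hA' : (0 : ℝ) < (2 * n + 1) ^ γ := by positivity
  refine le_trans ?_ (mul_le_mul_right (hg ((2 * n + 1) * h) (by positivity)) _)
  rw [← ENNReal.mul_rpow_of_nonneg _ _ hs.le, Real.mul_rpow hA.le hh.le,
    ENNReal.ofReal_mul hA'.le, mul_comm, ENNReal.mul_div_right_comm.symm,
    mul_comm (ENNReal.ofReal ((2 * (n : ℝ) + 1) ^ γ)),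
    ENNReal.mul_div_mul_right _ _ (by simpa using hA') ENNReal.ofReal_ne_top, cellDensity]
  have h1 : σ.restrict B (tripleCell h (cellIndex h x)) ≤ σ (ball x ((2 * n + 1) * h)) :=
    (Measure.restrict_apply_le _ _).trans (measure_mono (tripleCell_subset_ball hh x))
  gcongr

lemma monotone_indicator_Ioc_restrict_ball {n : ℕ} (σ : Measure (EuclideanSpace ℝ (Fin n)))
    (x : EuclideanSpace ℝ (Fin n)) :
    Monotone fun N : ℕ => (Ioc ((2 : ℝ) ^ N)⁻¹ (2 ^ N)).indicator
      fun ρ => σ.restrict (ball 0 N) (ball x ρ) := by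
  intro i j hij ρ
  simp only
  by_cases hρ : ρ ∈ Ioc ((2 : ℝ) ^ i)⁻¹ (2 ^ i)
  · have h4 : (2 : ℝ) ^ i ≤ 2 ^ j := pow_le_pow_right₀ (by norm_num) hij
    have hρ' : ρ ∈ Ioc ((2 : ℝ) ^ j)⁻¹ (2 ^ j) :=
      ⟨lt_of_le_of_lt (by gcongr) hρ.1, hρ.2.trans h4⟩
    rw [indicator_of_mem hρ, indicator_of_mem hρ']
    refine Measure.restrict_mono (ball_subset_ball ?_) le_rfl _
    exact_mod_cast hij
  · rw [indicator_of_notMem hρ]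
    exact zero_le

lemma radialWolff_le_iSup_truncated {n : ℕ} {s γ : ℝ} (hs : 0 < s)
    (σ : Measure (EuclideanSpace ℝ (Fin n))) (x : EuclideanSpace ℝ (Fin n)) :
    radialWolff s γ (fun ρ => σ (ball x ρ)) ≤
      ⨆ N : ℕ, radialWolff s γ ((Ioc ((2 : ℝ) ^ N)⁻¹ (2 ^ N)).indicator
        fun ρ => σ.restrict (ball 0 N) (ball x ρ)) := by
  rw [← radialWolff_iSup hs fun N => ((monotone_measure_ball _ x).measurable).indicator
    measurableSet_Ioc]
  · refine radialWolff_mono hs.le fun ρ hρ => ?_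
    obtain ⟨N, hN⟩ := exists_nat_gt (max (ρ + dist x 0) ρ⁻¹)
    have h1 : ρ + dist x 0 < N := (le_max_left _ _).trans_lt hN
    have h2 : ρ⁻¹ < N := (le_max_right _ _).trans_lt hN
    have h3 : (N : ℝ) < 2 ^ N := by exact_mod_cast Nat.lt_two_pow_self
    refine le_trans ?_ (le_iSup _ N)
    rw [indicator_of_mem, Measure.restrict_apply measurableSet_ball,
      inter_eq_left.2 (ball_subset_ball' h1.le)]
    refine ⟨?_, ?_⟩
    · rw [inv_lt_comm₀ (by positivity) hρ]
      linarith
    · linarith [dist_nonneg (x := x) (y := 0)]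
  · exact monotone_indicator_Ioc_restrict_ball σ x

lemma radialWolff_truncated_le {n : ℕ} {s γ s₀ : ℝ} (hs : 0 < s) (hγ : 0 ≤ γ) (hs₀ : 0 < s₀)
    (hs₀s : s₀ ≤ s) (ν : Measure (EuclideanSpace ℝ (Fin n))) (x : EuclideanSpace ℝ (Fin n))
    (N : ℕ) :
    radialWolff s γ ((Ioc ((2 : ℝ) ^ N)⁻¹ (2 ^ N)).indicator fun ρ => ν (ball x ρ)) ≤
      ENNReal.ofReal (2 ^ γ) ^ s * (∑ k ∈ Finset.range (2 * N),
        cellDensity γ ν (2 ^ k * (2 * ((2 : ℝ) ^ N)⁻¹)) x ^ s₀) ^ (s / s₀) := by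
  set h : ℝ := ((2 : ℝ) ^ N)⁻¹ with hh
  have hh0 : 0 < h := by positivity
  have hK : (2 : ℝ) ^ N = 2 ^ (2 * N) * h := by
    rw [two_mul, pow_add, mul_assoc, mul_inv_cancel₀ (by positivity), mul_one]
  calc _ = ∫⁻ ρ in Ioi (0 : ℝ), (Ioc h (2 ^ N)).indicator
        (fun ρ => (ν (ball x ρ) / ENNReal.ofReal (ρ ^ γ)) ^ s / ENNReal.ofReal ρ) ρ := by
        refine lintegral_congr fun ρ => ?_
        by_cases hρ : ρ ∈ Ioc h (2 ^ N)
        · simp [indicator_of_mem hρ]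
        · simp [indicator_of_notMem hρ, hs]
    _ ≤ ∫⁻ ρ in Ioc h (2 ^ N),
        (ν (ball x ρ) / ENNReal.ofReal (ρ ^ γ)) ^ s / ENNReal.ofReal ρ := by
        rw [← lintegral_indicator measurableSet_Ioc]
        exact setLIntegral_le_lintegral _ _
    _ ≤ ∑ k ∈ Finset.range (2 * N),
        ENNReal.ofReal (2 ^ γ) ^ s * cellDensity γ ν (2 ^ k * (2 * h)) x ^ s := by
        rw [hK]
        refine (setLIntegral_Ioc_le_sum _ hh0 _).trans (Finset.sum_le_sum fun k _ => ?_)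
        have := setLIntegral_Ioc_wolff_le (h := 2 ^ k * h) (by positivity) hs hγ ν x
        rwa [show 2 ^ (k + 1) * h = 2 * (2 ^ k * h) by ring,
          show 2 ^ k * (2 * h) = 2 * (2 ^ k * h) by ring]
    _ ≤ _ := by
        rw [← Finset.mul_sum]
        gcongr
        refine le_trans (le_of_eq (Finset.sum_congr rfl fun k _ => ?_))
          (ennreal_sum_rpow_le _ _ ((one_le_div hs₀).2 hs₀s))
        rw [← ENNReal.rpow_mul, mul_div_cancel₀ _ hs₀.ne']

/-- The Muckenhoupt–Wheeden inequality for Wolff potentials, with an arbitrary majorant `G` of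
the fractional maximal function. -/
lemma exists_lintegral_radialWolff_rpow_le {n : ℕ} {s γ m : ℝ} (hs : 0 < s) (hγ0 : 0 < γ)
    (hγn : γ < n) (hm0 : 0 < m) (hsm : 1 < s * m) :
    ∃ C : ℝ≥0∞, C ≠ ⊤ ∧ ∀ (σ : Measure (EuclideanSpace ℝ (Fin n))),
      IsLocallyFiniteMeasure σ → ∀ G : EuclideanSpace ℝ (Fin n) → ℝ≥0∞,
      (∀ x t, 0 < t → (σ (ball x t) / ENNReal.ofReal (t ^ γ)) ^ s ≤ G x) →
      ∫⁻ x, radialWolff s γ (fun ρ => σ (ball x ρ)) ^ m ≤ C * ∫⁻ x, G x ^ m := by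
  obtain ⟨s₀, hs₀, hs₀1, hs₀s, hm₀⟩ :
      ∃ s₀ : ℝ, 0 < s₀ ∧ s₀ ≤ 1 ∧ s₀ ≤ s ∧ 1 < s / s₀ * m := by
    rcases le_total s 1 with h | h
    · exact ⟨s, hs, h, le_rfl, by rw [div_self hs.ne']; nlinarith⟩
    · exact ⟨1, one_pos, le_rfl, h, by rwa [div_one]⟩
  set A : ℝ≥0∞ := ENNReal.ofReal (2 ^ γ) ^ s with hA
  set A' : ℝ≥0∞ := ENNReal.ofReal ((2 * n + 1) ^ γ) ^ s with hA'
  set C₀ : ℝ≥0∞ := (ENNReal.ofReal (s / s₀ * m) * (ENNReal.ofReal (3 ^ (n * s₀)) *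
        (1 - ENNReal.ofReal (2 ^ (-((n - γ) * s₀))))⁻¹)) ^ (s / s₀ * m) with hC₀
  have hAt : A ≠ ⊤ := ENNReal.rpow_ne_top_of_nonneg hs.le ENNReal.ofReal_ne_top
  have hA't : A' ≠ ⊤ := ENNReal.rpow_ne_top_of_nonneg hs.le ENNReal.ofReal_ne_top
  have hC₀t : C₀ ≠ ⊤ := by
    refine ENNReal.rpow_ne_top_of_nonneg (by positivity) (ENNReal.mul_ne_top ENNReal.ofReal_ne_top
      (ENNReal.mul_ne_top ENNReal.ofReal_ne_top (ENNReal.inv_ne_top.2 ?_)))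
    rw [Ne, tsub_eq_zero_iff_le, not_le, ENNReal.ofReal_lt_one]
    exact Real.rpow_lt_one_of_one_lt_of_neg (by norm_num)
      (neg_neg_of_pos (mul_pos (by linarith) hs₀))
  refine ⟨A ^ m * (C₀ * A' ^ m), ?_, ?_⟩
  · exact ENNReal.mul_ne_top (ENNReal.rpow_ne_top_of_nonneg hm0.le hAt)
      (ENNReal.mul_ne_top hC₀t (ENNReal.rpow_ne_top_of_nonneg hm0.le hA't))
  intro σ hσ G hG
  let ν : ℕ → Measure (EuclideanSpace ℝ (Fin n)) := fun N => σ.restrict (ball 0 N)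
  have hνfin : ∀ N, IsFiniteMeasure (ν N) := fun N =>
    isFiniteMeasure_restrict.2 measure_ball_lt_top.ne
  let V : ℕ → EuclideanSpace ℝ (Fin n) → ℝ≥0∞ := fun N x =>
    ∑ k ∈ Finset.range (2 * N), cellDensity γ (ν N) (2 ^ k * (2 * ((2 : ℝ) ^ N)⁻¹)) x ^ s₀
  let F : ℕ → EuclideanSpace ℝ (Fin n) → ℝ≥0∞ := fun N x =>
    radialWolff s γ ((Ioc ((2 : ℝ) ^ N)⁻¹ (2 ^ N)).indicator fun ρ => ν N (ball x ρ))
  have hFmono : ∀ x, Monotone fun N => F N x := by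
    intro x i j hij
    exact radialWolff_mono hs.le fun ρ _ => monotone_indicator_Ioc_restrict_ball σ x hij ρ
  have hFV : ∀ N x, F N x ^ m ≤ A ^ m * V N x ^ (s / s₀ * m) := by
    intro N x
    rw [ENNReal.rpow_mul, ← ENNReal.mul_rpow_of_nonneg _ _ hm0.le]
    exact ENNReal.rpow_le_rpow
      (radialWolff_truncated_le hs hγ0.le hs₀ hs₀s (ν N) x N) hm0.le
  have hVm : ∀ N, Measurable fun x => A ^ m * V N x ^ (s / s₀ * m) := fun N =>
    ((Finset.measurable_fun_sum _ fun k _ =>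
      (measurable_cellDensity γ (ν N) _).pow_const s₀).pow_const _).const_mul _
  have hW : ∀ x, radialWolff s γ (fun ρ => σ (ball x ρ)) ^ m ≤
      Filter.liminf (fun N => A ^ m * V N x ^ (s / s₀ * m)) Filter.atTop := by
    intro x
    refine (ENNReal.rpow_le_rpow (radialWolff_le_iSup_truncated hs σ x) hm0.le).trans ?_
    rw [ennreal_iSup_rpow hm0]
    refine iSup_le fun N => Filter.le_liminf_of_le (by isBoundedDefault) ?_
    filter_upwards [Filter.eventually_ge_atTop N] with N' hN'
    exact (ENNReal.rpow_le_rpow (hFmono x hN') hm0.le).trans (hFV N' x)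
  have hV : ∀ N, ∫⁻ x, A ^ m * V N x ^ (s / s₀ * m) ≤
      A ^ m * (C₀ * A' ^ m) * ∫⁻ x, G x ^ m := by
    intro N
    have := hνfin N
    rw [lintegral_const_mul' _ _ (ENNReal.rpow_ne_top_of_nonneg hm0.le hAt), mul_assoc, mul_assoc,
      ← lintegral_const_mul' _ _ (ENNReal.rpow_ne_top_of_nonneg hm0.le hA't)]
    gcongr
    refine lintegral_sum_cellDensity_rpow_le (R := N) (by positivity) hs₀ hs₀1 hm₀ (ν N) ?_ _ ?_
    · rw [Measure.restrict_apply measurableSet_ball.compl, compl_inter_self, measure_empty]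
    · intro k _ x
      rw [show s₀ * (s / s₀ * m) = s * m by field_simp, ENNReal.rpow_mul,
        ← ENNReal.mul_rpow_of_nonneg _ _ hm0.le]
      exact ENNReal.rpow_le_rpow
        (cellDensity_restrict_rpow_le (by positivity) hs (hG x) _) hm0.le
  calc _ ≤ ∫⁻ x, Filter.liminf (fun N => A ^ m * V N x ^ (s / s₀ * m)) Filter.atTop :=
        lintegral_mono hW
    _ ≤ Filter.liminf (fun N => ∫⁻ x, A ^ m * V N x ^ (s / s₀ * m)) Filter.atTop :=
        lintegral_liminf_le hVm
    _ ≤ _ := (Filter.liminf_le_liminf (Filter.Eventually.of_forall hV)).trans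
        (Filter.liminf_const _).le

lemma embC_ball_ne_top_of_lintegral_intK_lt_top {n : ℕ} {α p q r : ℝ} (hp : 1 < p)
    (hq0 : 0 < q) (hqp : q < p - 1) (hγ : 0 ≤ (n : ℝ) - α * p) (hr : 0 < r)
    {σ : Measure (EuclideanSpace ℝ (Fin n))} (hK : ∫⁻ x, intK n α p q σ x ^ r < ⊤)
    (x₀ : EuclideanSpace ℝ (Fin n)) (t₀ : ℝ) : embC n α p q σ (ball x₀ t₀) ≠ ⊤ := by
  intro htop
  have hp1 : 0 < p - 1 := by linarith
  have he : 0 < q * (p - 1) / (p - 1 - q) := div_pos (by positivity) (by linarith)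
  have hs : 0 < 1 / (p - 1) := by positivity
  have hKtop : ∀ x, intK n α p q σ x = ⊤ := by
    intro x
    set t : ℝ := |t₀| + dist x₀ x + 1 with ht
    have ht0 : 0 < t := by positivity
    have hsub : ball x₀ t₀ ⊆ ball x t :=
      ball_subset_ball' (by linarith [le_abs_self t₀])
    have h1 : embC n α p q σ (ball x t) = ⊤ :=
      top_le_iff.1 (htop ▸ embC_mono n α p q hq0 σ hsub)
    have h2 := le_radialWolff hs.le hγ
      (m := fun ρ => embC n α p q σ (ball x ρ) ^ (q * (p - 1) / (p - 1 - q)))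
      (fun a b hab => ENNReal.rpow_le_rpow (monotone_embC_ball n α p q hq0 σ x hab) he.le) ht0
    rw [h1, ENNReal.top_rpow_of_pos he, ENNReal.top_div_of_ne_top ENNReal.ofReal_ne_top,
      ENNReal.top_rpow_of_pos hs, ENNReal.top_div_of_ne_top (by norm_num)] at h2
    exact top_le_iff.1 h2
  simp only [hKtop, ENNReal.top_rpow_of_pos hr, lintegral_const] at hK
  rw [ENNReal.top_mul (isOpen_univ.measure_pos volume Set.univ_nonempty).ne'] at hK
  exact lt_irrefl _ hK

lemma measure_ball_lt_top_of_radialWolff_lt_top {X : Type*} [PseudoMetricSpace X]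
    [MeasurableSpace X] {s γ : ℝ} (hs : 0 < s) (hγ : 0 ≤ γ) {ω : Measure X} {x : X}
    (h : radialWolff s γ (fun ρ => ω (ball x ρ)) < ⊤) (y : X) (t : ℝ) : ω (ball y t) < ⊤ := by
  set T : ℝ := |t| + dist y x + 1 with hT
  have hT0 : 0 < T := by positivity
  refine lt_of_le_of_lt (measure_mono
    (ball_subset_ball' (by linarith [le_abs_self t]) : ball y t ⊆ ball x T)) ?_
  by_contra! htop
  have h2 := le_radialWolff hs.le hγ (monotone_measure_ball ω x) hT0
  rw [top_le_iff.1 htop, ENNReal.top_div_of_ne_top ENNReal.ofReal_ne_top,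
    ENNReal.top_rpow_of_pos hs, ENNReal.top_div_of_ne_top (by norm_num)] at h2
  exact (h2.trans_lt h).ne rfl

lemma lintegral_wolffPot_rpow_lt_top_of_intK {n : ℕ} {α p q r : ℝ} (hp : 1 < p)
    (hq0 : 0 < q) (hqp : q < p - 1) (hα : 0 < α * p) (hγ : 0 < (n : ℝ) - α * p)
    (hr : (n : ℝ) * (p - 1) / ((n : ℝ) - α * p) < r)
    {σ : Measure (EuclideanSpace ℝ (Fin n))} [IsLocallyFiniteMeasure σ]
    (hK : ∫⁻ x, intK n α p q σ x ^ r < ⊤) :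
    ∫⁻ x, wolffPot n α p σ x ^ ((p - 1) / (p - 1 - q) * r) < ⊤ := by
  have hp1 : 0 < p - 1 := by linarith
  have hpq : 0 < p - 1 - q := by linarith
  have hr1 : p - 1 < r := by
    refine lt_trans ?_ hr
    rw [lt_div_iff₀ hγ]
    nlinarith [mul_pos hα hp1]
  have hr0 : 0 < r := hp1.trans hr1
  set m : ℝ := (p - 1) / (p - 1 - q) * r with hm
  have hm0 : 0 < m := by positivity
  have hsm : 1 < 1 / (p - 1) * m := by
    rw [hm, show 1 / (p - 1) * ((p - 1) / (p - 1 - q) * r) = r / (p - 1 - q) by field_simp,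
      one_lt_div hpq]
    linarith
  obtain ⟨C, hC, h⟩ := exists_lintegral_radialWolff_rpow_le (n := n) (s := 1 / (p - 1))
    (γ := n - α * p) (by positivity) hγ (by linarith) hm0 hsm
  obtain ⟨C', hC', h'⟩ := exists_measure_ball_le_intK (n := n) (α := α) hp hq0 hqp hγ.le
  refine (h σ inferInstance _ (h' σ)).trans_lt ?_
  have hηm : (p - 1 - q) / (p - 1) * m = r := by
    rw [hm]; field_simp
  simp_rw [ENNReal.mul_rpow_of_nonneg _ _ hm0.le, ← ENNReal.rpow_mul, hηm]
  have hC'm : C' ^ m ≠ ⊤ := ENNReal.rpow_ne_top_of_nonneg hm0.le hC'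
  rw [lintegral_const_mul' _ _ hC'm]
  exact ENNReal.mul_lt_top hC.lt_top (ENNReal.mul_lt_top hC'm.lt_top hK)

/-- For `n(p−1)/(n−αp) < r < ∞` and `σ ≠ 0`, a solution of `u = W_{α,p}(u^q dσ)`
which is positive Lebesgue-a.e. and belongs to `L^r(ℝⁿ)` exists iff
`K_{α,p,q}σ ∈ L^r(ℝⁿ)`. -/
theorem exists_positive_Lr_solution_iff (n : ℕ) (hn : 1 ≤ n) (α p q r : ℝ)
    (hp : 1 < p) (hq0 : 0 < q) (hqp : q < p - 1)
    (hα0 : 0 < α) (hαp : α < n / p)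
    (hr : (n : ℝ) * (p - 1) / ((n : ℝ) - α * p) < r)
    (σ : Measure (EuclideanSpace ℝ (Fin n))) (hσloc : IsLocallyFiniteMeasure σ)
    (hσ : σ ≠ 0) :
    (∃ u : EuclideanSpace ℝ (Fin n) → ℝ≥0∞, IsSolution n α p q σ u ∧
        (∀ᵐ x ∂(volume : Measure (EuclideanSpace ℝ (Fin n))), 0 < u x) ∧
        (∫⁻ x, u x ^ r) < ⊤) ↔
      (∫⁻ x, intK n α p q σ x ^ r) < ⊤ := by
  have hp0 : 0 < p := by linarith
  have hp1 : 0 < p - 1 := by linarith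
  have hpq : 0 < p - 1 - q := by linarith
  have hα : 0 < α * p := mul_pos hα0 hp0
  have hγ : 0 < (n : ℝ) - α * p := by
    rw [lt_div_iff₀ hp0] at hαp
    linarith
  have hr0 : 0 < r := lt_of_le_of_lt (by positivity) hr
  constructor
  · rintro ⟨u, hu, hpos, hur⟩
    exact lintegral_intK_rpow_lt_top_of_isSolution hp hq0 hqp hγ.le hr0.le hu hpos hur
  intro hK
  obtain ⟨C, u, hC, hum, hsol, hpos, hle⟩ := exists_solution_le_intK_add hp hq0 hqp hγ hα σ hσ
    (embC_ball_ne_top_of_lintegral_intK_lt_top hp hq0 hqp hγ.le hr0 hK)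
  have hW := lintegral_wolffPot_rpow_lt_top_of_intK hp hq0 hqp hα hγ hr hK
  have hur : ∫⁻ x, u x ^ r < ⊤ := by
    have h2 : ∀ᵐ x ∂(volume : Measure (EuclideanSpace ℝ (Fin n))), u x ^ r ≤
        C ^ r * 2 ^ r * (intK n α p q σ x ^ r +
          wolffPot n α p σ x ^ ((p - 1) / (p - 1 - q) * r)) := by
      filter_upwards [hle] with x hx
      refine (ENNReal.rpow_le_rpow hx hr0.le).trans ?_
      rw [ENNReal.mul_rpow_of_nonneg _ _ hr0.le, mul_assoc, ENNReal.rpow_mul]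
      gcongr
      exact ennreal_add_rpow_le hr0.le _ _
    have hCr : C ^ r * 2 ^ r ≠ ⊤ := ENNReal.mul_ne_top
      (ENNReal.rpow_ne_top_of_nonneg hr0.le hC) (ENNReal.rpow_ne_top_of_nonneg hr0.le (by norm_num))
    have hWm : Measurable (wolffPot n α p σ) := measurable_radialWolff_ball _ _ σ
    refine (lintegral_mono_ae h2).trans_lt ?_
    rw [lintegral_const_mul' _ _ hCr, lintegral_add_right _ (hWm.pow_const _)]
    exact ENNReal.mul_lt_top hCr.lt_top (ENNReal.add_lt_top.2 ⟨hK, hW⟩)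
  have hfin : ∀ᵐ x ∂(volume : Measure (EuclideanSpace ℝ (Fin n))), u x ^ r < ⊤ :=
    ae_lt_top (hum.pow_const r) hur.ne
  obtain ⟨x, hx⟩ := hfin.exists
  rw [ENNReal.rpow_lt_top_iff_of_pos hr0, hsol x] at hx
  refine ⟨u, ⟨hum, fun y t _ => ?_, .of_forall hsol, .of_forall hsol⟩, .of_forall hpos, hur⟩
  rw [← withDensity_apply _ measurableSet_ball]
  exact measure_ball_lt_top_of_radialWolff_lt_top (one_div_pos.2 hp1) hγ.le hx y t
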